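/- arXiv:1501.02497 — 3 statements merged into one kernel-verified Lean document; each statement's English description precedes it below -/
import Mathlib

section
/- Second-order identifiability of the generalized logistic family (Theorem 3.3(a)): Fix positive integers p and q and let f(x|θ,σ) = (1/σ)·(Γ(p+q)/(Γ(p)Γ(q)))·exp(p(x−θ)/σ)/(1 + exp((x−θ)/σ))^{p+q} for x ∈ ℝ, with location θ ∈ ℝ and scale σ > 0. Then the family {f(·|θ,σ) : θ ∈ ℝ, σ > 0} is identifiable in the second order: for any k ≥ 1, any k distinct pairs (θ₁,σ₁),…,(θ_k,σ_k) ∈ ℝ×(0,∞), and any real coefficients α_j, β_j⁽¹⁾, β_j⁽²⁾, γ_j⁽¹¹⁾, γ_j⁽¹²⁾, γ_j⁽²²⁾ (1 ≤ j ≤ k), if Σ_{j=1}^k [α_j f + β_j⁽¹⁾ ∂f/∂θ + β_j⁽²⁾ ∂f/∂σ + γ_j⁽¹¹⁾ ∂²f/∂θ² + γ_j⁽¹²⁾ ∂²f/∂θ∂σ + γ_j⁽²²⁾ ∂²f/∂σ²] (x|θ_j,σ_j) = 0 for almost every x ∈ ℝ, then all of these coefficients are zero. -/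
open MeasureTheory

noncomputable section

/-- The generalized univariate logistic density with location `θ` and scale `σ`:
`f(x|θ,σ) = (1/σ) (Γ(p+q)/(Γ(p)Γ(q))) exp(p(x−θ)/σ) / (1+exp((x−θ)/σ))^{p+q}`. -/
def glogistic (p q : ℕ) (θ σ x : ℝ) : ℝ :=
  (1 / σ) * (Real.Gamma ((p : ℝ) + (q : ℝ)) / (Real.Gamma (p : ℝ) * Real.Gamma (q : ℝ))) *
    Real.exp ((p : ℝ) * ((x - θ) / σ)) / (1 + Real.exp ((x - θ) / σ)) ^ (p + q)

/-- First partial derivative of a two-parameter family in its first parameter. -/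
def pd₁ (f : ℝ → ℝ → ℝ → ℝ) (θ σ x : ℝ) : ℝ := deriv (fun t => f t σ x) θ

/-- First partial derivative in the second parameter. -/
def pd₂ (f : ℝ → ℝ → ℝ → ℝ) (θ σ x : ℝ) : ℝ := deriv (fun s => f θ s x) σ

/-- Second partial derivative in the first parameter. -/
def pd₁₁ (f : ℝ → ℝ → ℝ → ℝ) (θ σ x : ℝ) : ℝ := deriv (fun t => pd₁ f t σ x) θ

/-- Mixed second partial derivative. -/
def pd₁₂ (f : ℝ → ℝ → ℝ → ℝ) (θ σ x : ℝ) : ℝ := deriv (fun s => pd₁ f θ s x) σ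

/-- Second partial derivative in the second parameter. -/
def pd₂₂ (f : ℝ → ℝ → ℝ → ℝ) (θ σ x : ℝ) : ℝ := deriv (fun s => pd₂ f θ s x) σ

/-- A finite sum of quotients of entire functions that vanishes on the real line has no pole:
if only the first denominator vanishes at `z`, then so does the first numerator. -/
theorem numerator_eq_zero_of_isolated_pole {ι : Type*} [DecidableEq ι] (T : Finset ι)
    (f D₀ : ℂ → ℂ) (F D : ι → ℂ → ℂ) (n N : ℕ) (hn : n ≠ 0)
    (hf : Differentiable ℂ f) (hD₀ : Differentiable ℂ D₀)
    (hF : ∀ j, Differentiable ℂ (F j)) (hD : ∀ j, Differentiable ℂ (D j))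
    (hD₀_real : ∀ x : ℝ, D₀ x ≠ 0) (hD_real : ∀ j, ∀ x : ℝ, D j x ≠ 0)
    (hsum : ∀ x : ℝ, f x / D₀ x ^ n + ∑ j ∈ T, F j x / D j x ^ N = 0)
    {z : ℂ} (hz : D₀ z = 0) (hDz : ∀ j ∈ T, D j z ≠ 0) : f z = 0 := by
  set G : ℂ → ℂ := fun w => f w * ∏ j ∈ T, D j w ^ N +
    D₀ w ^ n * ∑ j ∈ T, F j w * ∏ l ∈ T.erase j, D l w ^ N with hG
  have hGd : Differentiable ℂ G := by
    rw [hG]; fun_prop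
  have hG_real : ∀ x : ℝ, G x = 0 := by
    intro x
    have h1 : ∑ j ∈ T, F j x * ∏ l ∈ T.erase j, D l x ^ N =
        (∏ j ∈ T, D j x ^ N) * ∑ j ∈ T, F j x / D j x ^ N := by
      rw [Finset.mul_sum]
      refine Finset.sum_congr rfl fun j hj => ?_
      rw [← Finset.mul_prod_erase T (fun j => D j x ^ N) hj]
      have := pow_ne_zero N (hD_real j x)
      field_simp
    have h2 : f x = -(D₀ x ^ n * ∑ j ∈ T, F j x / D j x ^ N) := by
      have := pow_ne_zero n (hD₀_real x)
      have h3 := eq_neg_of_add_eq_zero_left (hsum x)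
      rw [div_eq_iff this] at h3
      rw [h3]; ring
    simp only [hG]
    rw [h1, h2]; ring
  have hfreq : ∃ᶠ w in nhdsWithin (0 : ℂ) {0}ᶜ, G w = (fun _ => (0 : ℂ)) w := by
    have ht : Filter.Tendsto (fun x : ℝ => (x : ℂ)) (nhdsWithin 0 {0}ᶜ)
        (nhdsWithin (0 : ℂ) {0}ᶜ) := by
      refine tendsto_nhdsWithin_iff.2 ⟨?_, ?_⟩
      · exact (Complex.continuous_ofReal.tendsto' 0 0 (by simp)).mono_left nhdsWithin_le_nhds
      · filter_upwards [self_mem_nhdsWithin] with x hx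
        simpa using hx
    exact ht.frequently (Filter.Eventually.of_forall hG_real).frequently
  have hG0 : G = fun _ => (0 : ℂ) :=
    AnalyticOnNhd.eq_of_frequently_eq (fun w _ => hGd.analyticAt w)
      (fun w _ => analyticAt_const) hfreq
  have hGz : G z = 0 := congrFun hG0 z
  simp only [hG, hz, zero_pow hn, zero_mul, add_zero] at hGz
  exact (mul_eq_zero.1 hGz).resolve_right
    (Finset.prod_ne_zero_iff.2 fun j hj => pow_ne_zero N (hDz j hj))

/-- The integer multiples of a real number greater than `1` avoid some congruence class of
integers containing `1`. -/
theorem exists_forall_ne_mul_of_one_lt {r : ℝ} (hr : 1 < r) :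
    ∃ s : ℕ, 0 < s ∧ ∀ M : ℤ, (s : ℤ) ∣ M - 1 → ∀ L : ℤ, (M : ℝ) ≠ r * L := by
  by_cases h : ∃ t : ℚ, (t : ℝ) = r
  · obtain ⟨t, rfl⟩ := h
    have ht : 1 < t := by exact_mod_cast hr
    have hnum : 0 < t.num := Rat.num_pos.2 (by linarith)
    refine ⟨t.num.natAbs, by omega, fun M hM L hML => ?_⟩
    have hML' : (M : ℚ) = t * L := by exact_mod_cast hML
    have hden : (t.den : ℚ) ≠ 0 := by exact_mod_cast t.den_ne_zero
    have h1 : M * t.den = t.num * L := by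
      have h2 : (M : ℚ) * t.den = t.num * L := by
        rw [hML']
        nth_rewrite 1 [← Rat.num_div_den t]
        field_simp
      exact_mod_cast h2
    have hdvd : t.num ∣ M := by
      have hc : IsCoprime t.num (t.den : ℤ) := by
        rw [Int.isCoprime_iff_gcd_eq_one]
        exact t.reduced
      exact hc.dvd_of_dvd_mul_right ⟨L, h1⟩
    have hM' : t.num ∣ M - 1 := by simpa [abs_of_pos hnum] using hM
    have h1 : t.num ∣ 1 := by simpa using dvd_sub hdvd hM'
    have h2 : t.num = 1 := Int.eq_one_of_dvd_one hnum.le h1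
    have h3 : (t.den : ℚ) < t.num := by
      have hd : (0 : ℚ) < t.den := by exact_mod_cast t.den_pos
      rw [← Rat.num_div_den t, lt_div_iff₀ hd] at ht
      linarith
    have h4 : (t.den : ℤ) < t.num := by exact_mod_cast h3
    have := t.den_pos
    omega
  · refine ⟨2, two_pos, fun M hM L hML => h ⟨M / L, ?_⟩⟩
    have hL : (L : ℝ) ≠ 0 := by
      intro hL
      rw [hL, mul_zero] at hML
      have hM0 : M = 0 := by exact_mod_cast hML
      omega
    push_cast
    rw [hML]; field_simp

/-- The complexified denominator `1 + exp u` at `u = (z - θ) / σ`. -/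
def logisticDenom (φ : ℝ × ℝ) (z : ℂ) : ℂ := 1 + Complex.exp ((z - φ.1) / φ.2)

theorem differentiable_logisticDenom (φ : ℝ × ℝ) : Differentiable ℂ (logisticDenom φ) := by
  unfold logisticDenom; fun_prop

theorem logisticDenom_ofReal_ne_zero (φ : ℝ × ℝ) (x : ℝ) : logisticDenom φ x ≠ 0 := by
  have : logisticDenom φ x = ((1 + Real.exp ((x - φ.1) / φ.2) : ℝ) : ℂ) := by
    simp [logisticDenom]
  rw [this]
  exact_mod_cast (by positivity : 1 + Real.exp ((x - φ.1) / φ.2) ≠ 0)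

theorem exists_int_of_logisticDenom_eq_zero {φ ψ : ℝ × ℝ} (hψ : 0 < ψ.2) {M : ℤ}
    (h : logisticDenom ψ (φ.1 + φ.2 * (M * (Real.pi * Complex.I))) = 0) :
    φ.1 = ψ.1 ∧ ∃ L : ℤ, φ.2 * M = ψ.2 * L := by
  have h1 := eq_neg_of_add_eq_zero_right h
  rw [← Complex.exp_pi_mul_I, Complex.exp_eq_exp_iff_exists_int] at h1
  obtain ⟨n, hn⟩ := h1
  have hψ' : (ψ.2 : ℂ) ≠ 0 := by exact_mod_cast hψ.ne'
  rw [div_eq_iff hψ'] at hn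
  have hre := congrArg Complex.re hn
  have him := congrArg Complex.im hn
  simp at hre him
  refine ⟨by linarith, 1 + 2 * n, ?_⟩
  push_cast
  apply mul_right_cancel₀ Real.pi_ne_zero
  linarith

/-- The numerator, over the denominator `(1 + exp u) ^ (p + q + 2)`, of the combination of
`exp (p u) / (1 + exp u) ^ (p + q)` and its first two derivatives in `u` with coefficients `a`,
`b + c u` and `d + e u + m u ^ 2`. -/
def logisticNumerator (p q : ℕ) (a b c d e m : ℝ) (u : ℂ) : ℂ :=
  Complex.exp (p * u) * (a * (1 + Complex.exp u) ^ 2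
    + (b + c * u) * (p - q * Complex.exp u) * (1 + Complex.exp u)
    + (d + e * u + m * u ^ 2) *
      ((p - q * Complex.exp u) ^ 2 - (p + q) * Complex.exp u))

theorem exp_odd_mul_pi_mul_I {M : ℤ} (hM : Odd M) :
    Complex.exp (M * (Real.pi * Complex.I)) = -1 := by
  rw [Complex.exp_int_mul, Complex.exp_pi_mul_I, hM.neg_one_zpow]

theorem coefficients_eq_zero_of_isolated_poles {ι : Type*} [DecidableEq ι]
    {p q : ℕ} (hp : 0 < p) (T : Finset ι) (F : ι → ℂ → ℂ)
    (φ : ℝ × ℝ) (ψ : ι → ℝ × ℝ) (N : ℕ) (hφ : 0 < φ.2) (hF : ∀ j, Differentiable ℂ (F j))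
    (a b c d e m : ℝ)
    (hsum : ∀ x : ℝ, logisticNumerator p q a b c d e m ((x - φ.1) / φ.2) /
        logisticDenom φ x ^ (p + q + 2) +
      ∑ j ∈ T, F j x / logisticDenom (ψ j) x ^ N = 0)
    (s : ℤ) (hs : 0 < s)
    (hpole : ∀ M : ℤ, s ∣ M - 1 → ∀ j ∈ T,
      logisticDenom (ψ j) (φ.1 + φ.2 * (M * (Real.pi * Complex.I))) ≠ 0) :
    a = 0 ∧ b = 0 ∧ c = 0 ∧ d = 0 ∧ e = 0 ∧ m = 0 := by
  have hφ' : (φ.2 : ℂ) ≠ 0 := by exact_mod_cast hφ.ne'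
  have key : ∀ (n : ℕ) (f : ℂ → ℂ), n ≠ 0 → Differentiable ℂ f →
      (∀ x : ℝ, f ((x - φ.1) / φ.2) / logisticDenom φ x ^ n =
        logisticNumerator p q a b c d e m ((x - φ.1) / φ.2) /
          logisticDenom φ x ^ (p + q + 2)) →
      ∀ M : ℤ, Odd M → s ∣ M - 1 → f (M * (Real.pi * Complex.I)) = 0 := by
    intro n f hn hf hfx M hM hsM
    have harg : ((φ.1 + φ.2 * (M * (Real.pi * Complex.I))) - φ.1) / φ.2 =
        M * (Real.pi * Complex.I) := by field_simp; ring
    have := numerator_eq_zero_of_isolated_pole T (fun z => f ((z - φ.1) / φ.2))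
      (logisticDenom φ) F (fun j => logisticDenom (ψ j)) n N hn
      (hf.comp (by fun_prop)) (differentiable_logisticDenom φ) hF
      (fun j => differentiable_logisticDenom (ψ j)) (logisticDenom_ofReal_ne_zero φ)
      (fun j => logisticDenom_ofReal_ne_zero (ψ j))
      (fun x => by rw [hfx]; exact hsum x)
      (z := φ.1 + φ.2 * (M * (Real.pi * Complex.I)))
      (by rw [logisticDenom, harg, exp_odd_mul_pi_mul_I hM]; norm_num) (hpole M hsM)
    simpa only [harg] using this
  have hpi := Real.pi_pos
  have hpq : ((p : ℂ) + q) ≠ 0 := by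
    exact_mod_cast (by omega : p + q ≠ 0)
  have hpq1 : ((p : ℂ) + q + 1) ≠ 0 := by
    exact_mod_cast (by omega : p + q + 1 ≠ 0)
  have hquad : ∀ M : ℤ, Odd M → s ∣ M - 1 →
      d - m * (M * Real.pi) ^ 2 = 0 ∧ e * (M * Real.pi) = 0 := by
    intro M hM hsM
    have h := key (p + q + 2) (logisticNumerator p q a b c d e m) (by omega)
      (by unfold logisticNumerator; fun_prop) (fun x => rfl) M hM hsM
    rw [logisticNumerator, exp_odd_mul_pi_mul_I hM] at h
    have h2 : ((p : ℂ) + q) * (p + q + 1) *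
        (d + e * (M * (Real.pi * Complex.I)) + m * (M * (Real.pi * Complex.I)) ^ 2) = 0 := by
      rw [← (mul_eq_zero.1 h).resolve_left (Complex.exp_ne_zero _)]
      ring
    have h3 := (mul_eq_zero.1 h2).resolve_left (mul_ne_zero hpq hpq1)
    have h4 : (((d - m * (M * Real.pi) ^ 2 : ℝ) : ℂ)
        + ((e * (M * Real.pi) : ℝ) : ℂ) * Complex.I) = 0 := by
      rw [← h3]; push_cast
      linear_combination (-(m : ℂ) * M ^ 2 * Real.pi ^ 2) * Complex.I_sq
    have hre := congrArg Complex.re h4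
    have him := congrArg Complex.im h4
    rw [Complex.add_re, Complex.re_ofReal_mul, Complex.ofReal_re, Complex.I_re] at hre
    rw [Complex.add_im, Complex.im_ofReal_mul, Complex.ofReal_im, Complex.I_im] at him
    simp only [mul_zero, add_zero, mul_one, zero_add, Complex.zero_re, Complex.zero_im] at hre him
    exact ⟨hre, him⟩
  obtain ⟨h1, h1'⟩ := hquad 1 odd_one (by simp)
  obtain ⟨h2, -⟩ := hquad (1 + 2 * s) (by simp [parity_simps]) ⟨2, by ring⟩
  have he : e = 0 := by simpa [hpi.ne'] using h1'
  have hm : m = 0 := by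
    have hs' : (0 : ℝ) < s := by exact_mod_cast hs
    have h3 : m * (Real.pi ^ 2 * (4 * s * (s + 1))) = 0 := by
      push_cast at h1 h2
      linear_combination h1 - h2
    exact (mul_eq_zero.1 h3).resolve_right (by positivity)
  have hd : d = 0 := by simpa [hm] using h1
  subst hd he hm
  have hlin := key (p + q + 1) (fun u => Complex.exp (p * u) * (a * (1 + Complex.exp u)
      + (b + c * u) * (p - q * Complex.exp u))) (by omega) (by fun_prop)
      (fun x => by
        have := logisticDenom_ofReal_ne_zero φ x
        rw [pow_succ _ (p + q + 1), div_eq_div_iff (by positivity) (by positivity)]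
        simp only [logisticNumerator, logisticDenom]
        push_cast
        ring) 1 odd_one (by simp)
  have hbc : (b : ℂ) + c * (Real.pi * Complex.I) = 0 := by
    rw [exp_odd_mul_pi_mul_I odd_one] at hlin
    have h3 := (mul_eq_zero.1 hlin).resolve_left (Complex.exp_ne_zero _)
    refine (mul_eq_zero.1 ?_).resolve_left hpq
    rw [← h3]; push_cast; ring
  have hb : b = 0 := by simpa using congrArg Complex.re hbc
  have hc : c = 0 := by simpa [hpi.ne'] using congrArg Complex.im hbc
  subst hb hc
  have hconst := key (p + q) (fun u => Complex.exp (p * u) * a) (by omega) (by fun_prop)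
      (fun x => by
        have := logisticDenom_ofReal_ne_zero φ x
        rw [pow_add _ (p + q) 2, div_eq_div_iff (by positivity) (by positivity)]
        simp only [logisticNumerator, logisticDenom]
        push_cast
        ring) 1 odd_one (by simp)
  have ha : a = 0 := by simpa [Complex.exp_ne_zero] using hconst
  exact ⟨ha, rfl, rfl, rfl, rfl, rfl⟩

theorem logistic_coefficients_eq_zero {ι : Type*} [Fintype ι]
    {p q : ℕ} (hp : 0 < p) (φ : ι → ℝ × ℝ)
    (hφ : ∀ j, 0 < (φ j).2) (hinj : Function.Injective φ) (a b c d e m : ι → ℝ)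
    (hsum : ∀ x : ℝ, ∑ j,
      logisticNumerator p q (a j) (b j) (c j) (d j) (e j) (m j) ((x - (φ j).1) / (φ j).2) /
        logisticDenom (φ j) x ^ (p + q + 2) = 0) (j : ι) :
    a j = 0 ∧ b j = 0 ∧ c j = 0 ∧ d j = 0 ∧ e j = 0 ∧ m j = 0 := by
  classical
  set S : Finset ι := {j | ¬(a j = 0 ∧ b j = 0 ∧ c j = 0 ∧ d j = 0 ∧ e j = 0 ∧ m j = 0)}
    with hS
  by_contra hj
  obtain ⟨i, hi, hmin⟩ := S.exists_min_image (fun j => (φ j).2) ⟨j, by simpa [hS] using hj⟩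
  have hisol : ∀ l : ι, ∃ s : ℕ, 0 < s ∧ (l ∈ S.erase i → ∀ M : ℤ, (s : ℤ) ∣ M - 1 →
      logisticDenom (φ l) ((φ i).1 + (φ i).2 * (M * (Real.pi * Complex.I))) ≠ 0) := by
    intro l
    by_cases hl : l ∈ S.erase i
    · have hle := hmin l (Finset.mem_of_mem_erase hl)
      rcases hle.eq_or_lt with heq | hlt
      · refine ⟨1, one_pos, fun _ M _ h0 => Finset.ne_of_mem_erase hl (hinj ?_)⟩
        exact Prod.ext (exists_int_of_logisticDenom_eq_zero (hφ l) h0).1.symm heq.symm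
      · obtain ⟨s, hs, hsM⟩ := exists_forall_ne_mul_of_one_lt ((one_lt_div (hφ i)).2 hlt)
        refine ⟨s, hs, fun _ M hM h0 => ?_⟩
        obtain ⟨-, L, hL⟩ := exists_int_of_logisticDenom_eq_zero (hφ l) h0
        apply hsM M hM L
        rw [div_mul_eq_mul_div, eq_div_iff (hφ i).ne', ← hL, mul_comm]
    · exact ⟨1, one_pos, fun h => absurd h hl⟩
  choose s hs hsM using hisol
  refine (Finset.mem_filter.1 hi).2 (coefficients_eq_zero_of_isolated_poles (p := p) (q := q) hp
    (S.erase i)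
    (fun l z => logisticNumerator p q (a l) (b l) (c l) (d l) (e l) (m l)
      ((z - (φ l).1) / (φ l).2)) (φ i) φ (p + q + 2) (hφ i)
    (fun l => by unfold logisticNumerator; fun_prop) _ _ _ _ _ _ (fun x => ?_)
    (∏ l, s l : ℕ) (by exact_mod_cast Finset.prod_pos fun l _ => hs l)
    (fun M hM l hl => hsM l hl M (dvd_trans ?_ hM)))
  · rw [Finset.add_sum_erase S (fun l => logisticNumerator p q (a l) (b l) (c l) (d l) (e l) (m l)
      ((x - (φ l).1) / (φ l).2) / logisticDenom (φ l) x ^ (p + q + 2)) hi, ← hsum x]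
    refine Finset.sum_subset (Finset.subset_univ _) fun l _ hl => ?_
    have hl' : a l = 0 ∧ b l = 0 ∧ c l = 0 ∧ d l = 0 ∧ e l = 0 ∧ m l = 0 := by
      simpa only [hS, Finset.mem_filter, Finset.mem_univ, true_and, not_not] using hl
    obtain ⟨h1, h2, h3, h4, h5, h6⟩ := hl'
    simp [logisticNumerator, h1, h2, h3, h4, h5, h6]
  · exact_mod_cast Finset.dvd_prod_of_mem s (Finset.mem_univ l)

/-- The unnormalized standard logistic profile `exp (p u) / (1 + exp u) ^ (p + q)`. -/
def logisticProfile (p q : ℕ) (u : ℝ) : ℝ := Real.exp (p * u) / (1 + Real.exp u) ^ (p + q)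

/-- The logarithmic derivative of `logisticProfile`. -/
def logisticScore (p q : ℕ) (u : ℝ) : ℝ := (p - q * Real.exp u) / (1 + Real.exp u)

theorem hasDerivAt_logisticProfile (p q : ℕ) (u : ℝ) :
    HasDerivAt (logisticProfile p q) (logisticProfile p q u * logisticScore p q u) u := by
  have hE : 1 + Real.exp u ≠ 0 := by positivity
  have h := (((hasDerivAt_id u).const_mul (p : ℝ)).exp).div
    (((Real.hasDerivAt_exp u).const_add 1).pow (p + q)) (pow_ne_zero _ hE)
  refine h.congr_deriv ?_
  simp only [logisticProfile, logisticScore, id, mul_one]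
  rcases Nat.eq_zero_or_pos (p + q) with h0 | h0
  · obtain ⟨rfl, rfl⟩ : p = 0 ∧ q = 0 := by omega
    simp
  · obtain ⟨r, hr⟩ : ∃ r, p + q = r + 1 := ⟨p + q - 1, by omega⟩
    have hr' : (q : ℝ) = r + 1 - p := by
      have : (p : ℝ) + q = r + 1 := by exact_mod_cast hr
      linarith
    rw [hr, hr']
    simp only [Pi.pow_apply, Nat.add_sub_cancel]
    push_cast
    field_simp
    ring

theorem hasDerivAt_logisticScore (p q : ℕ) (u : ℝ) :
    HasDerivAt (logisticScore p q) (-(p + q) * Real.exp u / (1 + Real.exp u) ^ 2) u := by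
  have hE : 1 + Real.exp u ≠ 0 := by positivity
  have h := (((Real.hasDerivAt_exp u).const_mul (q : ℝ)).const_sub (p : ℝ)).div
    ((Real.hasDerivAt_exp u).const_add 1) hE
  refine h.congr_deriv ?_
  congr 1
  ring

/-- The second derivative of `logisticProfile`. -/
def logisticCurvature (p q : ℕ) (u : ℝ) : ℝ :=
  logisticProfile p q u *
    (((p - q * Real.exp u) ^ 2 - (p + q) * Real.exp u) / (1 + Real.exp u) ^ 2)

theorem hasDerivAt_profile_mul_score (p q : ℕ) (u : ℝ) :
    HasDerivAt (fun u => logisticProfile p q u * logisticScore p q u)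
      (logisticCurvature p q u) u := by
  refine ((hasDerivAt_logisticProfile p q u).mul (hasDerivAt_logisticScore p q u)).congr_deriv ?_
  have hE : 1 + Real.exp u ≠ 0 := by positivity
  simp only [logisticCurvature, logisticScore]
  field_simp
  ring

section LocationScale

variable {g g' g'' : ℝ → ℝ} {C : ℝ} {f : ℝ → ℝ → ℝ → ℝ}

theorem hasDerivAt_comp_location (hg : ∀ u, HasDerivAt g (g' u) u) (θ σ x : ℝ) :
    HasDerivAt (fun t => g ((x - t) / σ)) (-(g' ((x - θ) / σ) / σ)) θ := by
  have h := (hg ((x - θ) / σ)).comp θ (((hasDerivAt_id θ).const_sub x).div_const σ)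
  refine h.congr_deriv ?_
  ring

theorem hasDerivAt_comp_scale (hg : ∀ u, HasDerivAt g (g' u) u) (θ x : ℝ) {σ : ℝ} (hσ : σ ≠ 0) :
    HasDerivAt (fun s => g ((x - θ) / s)) (-((x - θ) / σ * g' ((x - θ) / σ) / σ)) σ := by
  have h := (hg ((x - θ) / σ)).comp σ ((hasDerivAt_inv hσ).const_mul (x - θ))
  refine h.congr_deriv ?_
  field_simp

theorem pd₁_locationScale (hg : ∀ u, HasDerivAt g (g' u) u)
    (hf : ∀ θ σ x, f θ σ x = C / σ * g ((x - θ) / σ)) (θ σ x : ℝ) :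
    pd₁ f θ σ x = -(C / σ ^ 2 * g' ((x - θ) / σ)) := by
  simp only [pd₁, hf]
  rw [((hasDerivAt_comp_location hg θ σ x).const_mul (C / σ)).deriv]
  ring

theorem pd₂_locationScale (hg : ∀ u, HasDerivAt g (g' u) u)
    (hf : ∀ θ σ x, f θ σ x = C / σ * g ((x - θ) / σ)) (θ x : ℝ) {σ : ℝ} (hσ : σ ≠ 0) :
    pd₂ f θ σ x =
      -(C / σ ^ 2 * (g ((x - θ) / σ) + (x - θ) / σ * g' ((x - θ) / σ))) := by
  simp only [pd₂, hf, div_eq_mul_inv C]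
  refine ((((hasDerivAt_inv hσ).const_mul C).mul
    (hasDerivAt_comp_scale hg θ x hσ)).congr_deriv ?_).deriv
  field_simp
  ring

theorem pd₁₁_locationScale (hg : ∀ u, HasDerivAt g (g' u) u)
    (hg' : ∀ u, HasDerivAt g' (g'' u) u)
    (hf : ∀ θ σ x, f θ σ x = C / σ * g ((x - θ) / σ)) (θ σ x : ℝ) :
    pd₁₁ f θ σ x = C / σ ^ 3 * g'' ((x - θ) / σ) := by
  simp only [pd₁₁, pd₁_locationScale hg hf]
  refine (((hasDerivAt_comp_location hg' θ σ x).const_mul (C / σ ^ 2)).neg.congr_deriv ?_).deriv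
  ring

theorem pd₁₂_locationScale (hg : ∀ u, HasDerivAt g (g' u) u)
    (hg' : ∀ u, HasDerivAt g' (g'' u) u)
    (hf : ∀ θ σ x, f θ σ x = C / σ * g ((x - θ) / σ)) (θ x : ℝ) {σ : ℝ} (hσ : σ ≠ 0) :
    pd₁₂ f θ σ x =
      C / σ ^ 3 * (2 * g' ((x - θ) / σ) + (x - θ) / σ * g'' ((x - θ) / σ)) := by
  simp only [pd₁₂, pd₁_locationScale hg hf, div_eq_mul_inv C]
  refine (((((hasDerivAt_pow 2 σ).inv (pow_ne_zero 2 hσ)).const_mul C).mul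
    (hasDerivAt_comp_scale hg' θ x hσ)).neg.congr_deriv ?_).deriv
  simp
  field_simp
  ring

theorem pd₂₂_locationScale (hg : ∀ u, HasDerivAt g (g' u) u)
    (hg' : ∀ u, HasDerivAt g' (g'' u) u)
    (hf : ∀ θ σ x, f θ σ x = C / σ * g ((x - θ) / σ)) (θ x : ℝ) {σ : ℝ} (hσ : σ ≠ 0) :
    pd₂₂ f θ σ x = C / σ ^ 3 * (2 * g ((x - θ) / σ) + 4 * ((x - θ) / σ) * g' ((x - θ) / σ)
      + ((x - θ) / σ) ^ 2 * g'' ((x - θ) / σ)) := by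
  have hev : (fun s => pd₂ f θ s x) =ᶠ[nhds σ] fun s =>
      -(C * (s ^ 2)⁻¹ * (g ((x - θ) / s) + (x - θ) * s⁻¹ * g' ((x - θ) / s))) := by
    filter_upwards [isOpen_ne.mem_nhds hσ] with s hs
    rw [pd₂_locationScale hg hf θ x hs, div_eq_mul_inv C, div_eq_mul_inv (x - θ)]
  rw [pd₂₂, hev.deriv_eq]
  refine (((((hasDerivAt_pow 2 σ).inv (pow_ne_zero 2 hσ)).const_mul C).mul
    ((hasDerivAt_comp_scale hg θ x hσ).add (((hasDerivAt_inv hσ).const_mul (x - θ)).mul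
      (hasDerivAt_comp_scale hg' θ x hσ)))).neg.congr_deriv ?_).deriv
  simp
  field_simp
  ring

end LocationScale

theorem glogistic_eq_locationScale (p q : ℕ) (θ σ x : ℝ) :
    glogistic p q θ σ x =
      Real.Gamma ((p : ℝ) + (q : ℝ)) / (Real.Gamma (p : ℝ) * Real.Gamma (q : ℝ)) / σ *
        logisticProfile p q ((x - θ) / σ) := by
  rw [glogistic, logisticProfile]
  ring

/-- **Theorem 3.3(a)**: the generalized univariate logistic family is identifiable in
the second order: no nonzero linear combination of the densities and their first- and
second-order partial derivatives in the parameters, at finitely many distinct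
parameter points, vanishes almost everywhere. -/
theorem generalized_logistic_second_order_identifiable
    (p q : ℕ) (hp : 0 < p) (hq : 0 < q)
    (k : ℕ) (hk : 1 ≤ k) (φ : Fin k → ℝ × ℝ)
    (hφ : ∀ j, 0 < (φ j).2) (hinj : Function.Injective φ)
    (α β₁ β₂ γ₁₁ γ₁₂ γ₂₂ : Fin k → ℝ)
    (hae : ∀ᵐ x ∂(volume : Measure ℝ),
      ∑ j, (α j * glogistic p q (φ j).1 (φ j).2 x
        + β₁ j * pd₁ (glogistic p q) (φ j).1 (φ j).2 x
        + β₂ j * pd₂ (glogistic p q) (φ j).1 (φ j).2 x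
        + γ₁₁ j * pd₁₁ (glogistic p q) (φ j).1 (φ j).2 x
        + γ₁₂ j * pd₁₂ (glogistic p q) (φ j).1 (φ j).2 x
        + γ₂₂ j * pd₂₂ (glogistic p q) (φ j).1 (φ j).2 x) = 0) :
    ∀ j, α j = 0 ∧ β₁ j = 0 ∧ β₂ j = 0 ∧ γ₁₁ j = 0 ∧ γ₁₂ j = 0 ∧ γ₂₂ j = 0 := by
  set C : ℝ := Real.Gamma ((p : ℝ) + (q : ℝ)) / (Real.Gamma (p : ℝ) * Real.Gamma (q : ℝ))
    with hC
  have hp' : (0 : ℝ) < p := by exact_mod_cast hp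
  have hq' : (0 : ℝ) < q := by exact_mod_cast hq
  have hCpos : 0 < C := div_pos (Real.Gamma_pos_of_pos (by positivity))
    (mul_pos (Real.Gamma_pos_of_pos hp') (Real.Gamma_pos_of_pos hq'))
  have hg := hasDerivAt_logisticProfile p q
  have hg' := hasDerivAt_profile_mul_score p q
  have hf : ∀ θ σ x, glogistic p q θ σ x = C / σ * logisticProfile p q ((x - θ) / σ) :=
    glogistic_eq_locationScale p q
  set a : Fin k → ℝ := fun j =>
    α j / (φ j).2 - β₂ j / (φ j).2 ^ 2 + 2 * γ₂₂ j / (φ j).2 ^ 3 with ha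
  set b : Fin k → ℝ := fun j => -(β₁ j / (φ j).2 ^ 2) + 2 * γ₁₂ j / (φ j).2 ^ 3 with hb
  set c : Fin k → ℝ := fun j => -(β₂ j / (φ j).2 ^ 2) + 4 * γ₂₂ j / (φ j).2 ^ 3 with hc
  set d : Fin k → ℝ := fun j => γ₁₁ j / (φ j).2 ^ 3 with hd
  set e : Fin k → ℝ := fun j => γ₁₂ j / (φ j).2 ^ 3 with he
  set m : Fin k → ℝ := fun j => γ₂₂ j / (φ j).2 ^ 3 with hm
  set G : Fin k → ℝ → ℝ := fun j u => Real.exp (p * u) * (a j * (1 + Real.exp u) ^ 2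
    + (b j + c j * u) * (p - q * Real.exp u) * (1 + Real.exp u)
    + (d j + e j * u + m j * u ^ 2) *
      ((p - q * Real.exp u) ^ 2 - (p + q) * Real.exp u)) / (1 + Real.exp u) ^ (p + q + 2) with hG
  have hterm : ∀ x j, α j * glogistic p q (φ j).1 (φ j).2 x
        + β₁ j * pd₁ (glogistic p q) (φ j).1 (φ j).2 x
        + β₂ j * pd₂ (glogistic p q) (φ j).1 (φ j).2 x
        + γ₁₁ j * pd₁₁ (glogistic p q) (φ j).1 (φ j).2 x
        + γ₁₂ j * pd₁₂ (glogistic p q) (φ j).1 (φ j).2 x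
        + γ₂₂ j * pd₂₂ (glogistic p q) (φ j).1 (φ j).2 x
        = C * G j ((x - (φ j).1) / (φ j).2) := by
    intro x j
    have hσ := (hφ j).ne'
    rw [pd₁_locationScale hg hf, pd₂_locationScale hg hf _ _ hσ,
      pd₁₁_locationScale hg hg' hf, pd₁₂_locationScale hg hg' hf _ _ hσ,
      pd₂₂_locationScale hg hg' hf _ _ hσ, hf]
    simp only [hG, ha, hb, hc, hd, he, hm]
    generalize (x - (φ j).1) / (φ j).2 = u
    simp only [logisticCurvature, logisticScore, logisticProfile]
    have hE : 1 + Real.exp u ≠ 0 := by positivity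
    generalize Real.exp u = E at *
    rw [pow_add _ (p + q) 2]
    field_simp
    ring
  simp only [hterm, ← Finset.mul_sum] at hae
  have hcont : Continuous fun x => C * ∑ j, G j ((x - (φ j).1) / (φ j).2) := by
    have hGc : ∀ j, Continuous (G j) := fun j => by
      refine Continuous.div (by fun_prop) (by fun_prop) fun u => ?_
      positivity
    fun_prop
  have hzero := (hcont.ae_eq_iff_eq volume continuous_const).1 hae
  have hsum : ∀ x : ℝ, ∑ j, G j ((x - (φ j).1) / (φ j).2) = 0 := fun x =>
    (mul_eq_zero.1 (congrFun hzero x)).resolve_left hCpos.ne'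
  intro j
  obtain ⟨h1, h2, h3, h4, h5, h6⟩ := logistic_coefficients_eq_zero (q := q) hp φ hφ hinj
    a b c d e m (fun x => by
      have h := congrArg (fun y : ℝ => (y : ℂ)) (hsum x)
      simp only [hG] at h
      push_cast at h
      simpa only [logisticNumerator, logisticDenom] using h) j
  have hσ := (hφ j).ne'
  have hγ₁₁ : γ₁₁ j = 0 := by simpa [hd, hσ] using h4
  have hγ₁₂ : γ₁₂ j = 0 := by simpa [he, hσ] using h5
  have hγ₂₂ : γ₂₂ j = 0 := by simpa [hm, hσ] using h6
  have hβ₁ : β₁ j = 0 := by simpa [hb, hγ₁₂, hσ] using h2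
  have hβ₂ : β₂ j = 0 := by simpa [hc, hγ₂₂, hσ] using h3
  have hα : α j = 0 := by simpa [ha, hβ₂, hγ₂₂, hσ] using h1
  exact ⟨hα, hβ₁, hβ₂, hγ₁₁, hγ₁₂, hγ₂₂⟩
end
end

section
/- First-order identifiability of the multivariate generalized Gaussian family (Theorem 3.4(a)): Let d ≥ 1 and define f(x|θ,Σ,m) = (m·Γ(d/2) / (π^{d/2} Γ(d/(2m)) det(Σ)^{1/2})) · exp(−((x−θ)ᵀΣ^{−1}(x−θ))^m) for x ∈ ℝ^d, with parameters θ ∈ ℝ^d, Σ ∈ S_d^{++}, and shape m ≥ 1. Then this family is identifiable in the first order: for any k ≥ 1, any k distinct triples (θ_j,Σ_j,m_j) ∈ ℝ^d × S_d^{++} × [1,∞), and any coefficients α_j ∈ ℝ, β_j ∈ ℝ^d, symmetric matrices γ_j ∈ ℝ^{d×d}, and η_j ∈ ℝ, if Σ_{j=1}^k [α_j f(x|θ_j,Σ_j,m_j) + β_jᵀ ∂f/∂θ(x|θ_j,Σ_j,m_j) + tr((∂f/∂Σ(x|θ_j,Σ_j,m_j))ᵀ γ_j) + η_j ∂f/∂m(x|θ_j,Σ_j,m_j)]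 = 0 for almost every x ∈ ℝ^d, then α_j = 0, β_j = 0, γ_j = 0 and η_j = 0 for all j. -/
open MeasureTheory Matrix

noncomputable section

abbrev Vec (d : ℕ) := Fin d → ℝ
abbrev Mat (d : ℕ) := Matrix (Fin d) (Fin d) ℝ

/-- The multivariate generalized Gaussian density with location `θ`, matrix
parameter `M` and shape `m`:
`f(x|θ,Σ,m) = m Γ(d/2)/(π^{d/2} Γ(d/(2m)) det(Σ)^{1/2}) exp(−((x−θ)ᵀΣ⁻¹(x−θ))^m)`. -/
def mvGenGauss (d : ℕ) (θ : Vec d) (M : Mat d) (m : ℝ) (x : Vec d) : ℝ :=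
  (m * Real.Gamma ((d : ℝ) / 2)) /
      (Real.pi ^ ((d : ℝ) / 2) * Real.Gamma ((d : ℝ) / (2 * m)) * Real.sqrt M.det) *
    Real.exp (-(((x - θ) ⬝ᵥ (M⁻¹ *ᵥ (x - θ))) ^ m))

/-- Directional derivative in the location parameter: `βᵀ ∂f/∂θ`. -/
def dThetaG (d : ℕ) (θ : Vec d) (M : Mat d) (m : ℝ) (β : Vec d) (x : Vec d) : ℝ :=
  deriv (fun t : ℝ => mvGenGauss d (θ + t • β) M m x) 0

/-- Directional derivative in the matrix parameter: `tr((∂f/∂Σ)ᵀ γ)`. -/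
def dSigmaG (d : ℕ) (θ : Vec d) (M : Mat d) (m : ℝ) (γ : Mat d) (x : Vec d) : ℝ :=
  deriv (fun t : ℝ => mvGenGauss d θ (M + t • γ) m x) 0

/-- Partial derivative in the shape parameter: `∂f/∂m`. -/
def dShapeG (d : ℕ) (θ : Vec d) (M : Mat d) (m : ℝ) (x : Vec d) : ℝ :=
  deriv (fun s : ℝ => mvGenGauss d θ M s x) m


open Filter Topology

section Asymptotics

open Asymptotics

theorem tendsto_quadratic_atTop {a : ℝ} (ha : 0 < a) (b c : ℝ) :
    Tendsto (fun t : ℝ => a * t ^ 2 + b * t + c) atTop atTop := by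
  have h : Tendsto (fun t : ℝ => t * (a * t + b)) atTop atTop :=
    tendsto_id.atTop_mul_atTop₀
      (tendsto_atTop_add_const_right _ b (tendsto_id.const_mul_atTop ha))
  refine (tendsto_atTop_add_const_right _ c h).congr fun t => ?_
  ring

theorem isBigO_quadratic (a b c : ℝ) :
    (fun t : ℝ => a * t ^ 2 + b * t + c) =O[atTop] fun t => t ^ 2 := by
  have h1 : (fun t : ℝ => t) =O[atTop] fun t => t ^ 2 := by
    simpa using (isLittleO_pow_pow_atTop_of_lt (𝕜 := ℝ) one_lt_two).isBigO
  have h0 : (fun _ : ℝ => c) =O[atTop] fun t : ℝ => t ^ 2 := by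
    refine (isLittleO_const_left.2 (Or.inr ?_)).isBigO
    exact tendsto_norm_atTop_atTop.comp (tendsto_pow_atTop two_ne_zero)
  exact (((isBigO_refl _ _).const_mul_left a).add (h1.const_mul_left b)).add h0

/-- For shapes at least one, lexicographic comparison of the shape and the two leading
coefficients of a quadratic polynomial compares the powers up to a linear gap. -/
theorem exists_linear_gap {a b c m a' b' c' m' : ℝ} (ha : 0 < a) (ha' : 0 < a')
    (hm : 1 ≤ m) (h : m < m' ∨ m = m' ∧ (a < a' ∨ a = a' ∧ b < b')) :
    ∃ ε > 0, ∀ᶠ t : ℝ in atTop,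
      ε * t ≤ (a' * t ^ 2 + b' * t + c') ^ m' - (a * t ^ 2 + b * t + c) ^ m := by
  have hQ := tendsto_quadratic_atTop ha b c
  have hQ' := tendsto_quadratic_atTop ha' b' c'
  rcases h with hmm | ⟨rfl, h⟩
  · refine ⟨1, one_pos, ?_⟩
    set K : ℝ := a / a' + 1 with hK
    have hKpos : 0 < K := by positivity
    have hKa : 0 < K * a' - a := by rw [hK]; field_simp; linarith
    have h1 := (tendsto_quadratic_atTop hKa (K * b' - b) (K * c' - c)).eventually_ge_atTop 0
    have h2 := (tendsto_quadratic_atTop ha (b - 1) c).eventually_ge_atTop 0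
    have h3 := ((tendsto_rpow_atTop (sub_pos.2 hmm)).comp hQ).eventually_ge_atTop (2 * K ^ m')
    filter_upwards [h1, h2, h3, hQ.eventually_ge_atTop 1, hQ'.eventually_ge_atTop 1]
      with t h1 h2 h3 h4 h5
    simp only [Function.comp_apply] at h3
    generalize hX : a * t ^ 2 + b * t + c = X at *
    generalize hY : a' * t ^ 2 + b' * t + c' = Y at *
    have hXY : X ≤ K * Y := by rw [← hX, ← hY]; linarith
    have htX : t ≤ X := by rw [← hX]; linarith
    have hpow : X ^ m' ≤ K ^ m' * Y ^ m' := by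
      rw [← Real.mul_rpow hKpos.le (by linarith)]
      exact Real.rpow_le_rpow (by linarith) hXY (by linarith)
    have hsplit : X ^ m' = X ^ (m' - m) * X ^ m := by
      rw [← Real.rpow_add (by linarith)]; ring_nf
    have hXm : X ≤ X ^ m := Real.self_le_rpow_of_one_le h4 hm
    have hKm : 0 < K ^ m' := Real.rpow_pos_of_pos hKpos _
    have : K ^ m' * (2 * X ^ m) ≤ K ^ m' * Y ^ m' := by
      calc K ^ m' * (2 * X ^ m) = 2 * K ^ m' * X ^ m := by ring
        _ ≤ X ^ (m' - m) * X ^ m := by gcongr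
        _ ≤ _ := hsplit ▸ hpow
    have := le_of_mul_le_mul_left this hKm
    linarith
  · obtain ⟨ε, hε, hgap⟩ : ∃ ε > 0, ∀ᶠ t : ℝ in atTop,
        ε * t ≤ (a' * t ^ 2 + b' * t + c') - (a * t ^ 2 + b * t + c) := by
      rcases h with h | ⟨rfl, h⟩
      · refine ⟨1, one_pos, ?_⟩
        filter_upwards [(tendsto_quadratic_atTop (sub_pos.2 h)
          (b' - b - 1) (c' - c)).eventually_ge_atTop 0] with t ht
        linarith
      · refine ⟨(b' - b) / 2, by linarith, ?_⟩
        have := tendsto_atTop_add_const_right atTop (c' - c)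
          (tendsto_id.const_mul_atTop (show 0 < (b' - b) / 2 by linarith))
        filter_upwards [this.eventually_ge_atTop 0] with t ht
        simp only [id] at ht
        linarith
    refine ⟨ε, hε, ?_⟩
    filter_upwards [hgap, hQ.eventually_ge_atTop 1, eventually_ge_atTop 0] with t h1 h2 h0
    generalize a * t ^ 2 + b * t + c = X at *
    generalize a' * t ^ 2 + b' * t + c' = Y at *
    have hXY : X ≤ Y := by nlinarith [mul_nonneg hε.le h0]
    have hX1 : 1 ≤ X ^ (m - 1) := Real.one_le_rpow h2 (by linarith)
    have hY1 : X ^ (m - 1) ≤ Y ^ (m - 1) :=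
      Real.rpow_le_rpow (by linarith) hXY (by linarith)
    have eX : X ^ m = X ^ (m - 1) * X := by
      rw [← Real.rpow_add_one (by linarith)]; ring_nf
    have eY : Y ^ m = Y ^ (m - 1) * Y := by
      rw [← Real.rpow_add_one (by linarith)]; ring_nf
    rw [eX, eY]
    nlinarith [mul_le_mul_of_nonneg_right hY1 (show 0 ≤ Y by linarith),
      mul_le_mul_of_nonneg_right hX1 (sub_nonneg.2 hXY)]

/-- The factor multiplying the exponential in a first-order perturbation along a line. -/
def lineFactor (a b c m κ r₂ r₁ r₀ η t : ℝ) : ℝ :=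
  κ + (a * t ^ 2 + b * t + c) ^ (m - 1) * (r₂ * t ^ 2 + r₁ * t + r₀)
    - η * ((a * t ^ 2 + b * t + c) ^ m * Real.log (a * t ^ 2 + b * t + c))

theorem tendsto_lineFactor_mul_exp {a b c m κ r₂ r₁ r₀ η ε : ℝ} (ha : 0 < a) (hm : 1 ≤ m)
    (hε : 0 < ε) :
    Tendsto (fun t => lineFactor a b c m κ r₂ r₁ r₀ η t * Real.exp (-(ε * t)))
      atTop (𝓝 0) := by
  have hQ := tendsto_quadratic_atTop ha b c
  have hQO := isBigO_quadratic a b c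
  have hpow : ∀ s : ℝ, 0 ≤ s → (fun t : ℝ => (a * t ^ 2 + b * t + c) ^ s) =O[atTop]
      fun t : ℝ => t ^ (2 * s) := by
    intro s hs
    have := hQO.rpow hs (Eventually.of_forall fun t => sq_nonneg t)
    refine this.congr' EventuallyEq.rfl ?_
    filter_upwards [eventually_ge_atTop 0] with t ht
    rw [← Real.rpow_natCast, ← Real.rpow_mul ht]; norm_num
  have hlittle : ∀ s : ℝ, (fun t : ℝ => t ^ s) =o[atTop] fun t => Real.exp (ε * t) :=
    fun s => isLittleO_rpow_exp_pos_mul_atTop s hε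
  have h1 : (fun _ : ℝ => κ) =o[atTop] fun t => Real.exp (ε * t) := by
    simpa using (hlittle 0).const_mul_left κ
  have h2 : (fun t : ℝ => (a * t ^ 2 + b * t + c) ^ (m - 1) * (r₂ * t ^ 2 + r₁ * t + r₀))
      =o[atTop] fun t => Real.exp (ε * t) := by
    refine IsBigO.trans_isLittleO
      (((hpow (m - 1) (by linarith)).mul (isBigO_quadratic r₂ r₁ r₀)).congr' EventuallyEq.rfl ?_)
      (hlittle (2 * m))
    filter_upwards [eventually_gt_atTop 0] with t ht
    rw [← Real.rpow_natCast, ← Real.rpow_add ht]; ring_nf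
  have h3 : (fun t : ℝ => (a * t ^ 2 + b * t + c) ^ m * Real.log (a * t ^ 2 + b * t + c))
      =o[atTop] fun t => Real.exp (ε * t) := by
    have hlog := (Real.isLittleO_log_id_atTop.comp_tendsto hQ).isBigO.trans hQO
    refine IsBigO.trans_isLittleO
      (((hpow m (by linarith)).mul hlog).congr' EventuallyEq.rfl ?_) (hlittle (2 * m + 2))
    filter_upwards [eventually_gt_atTop 0] with t ht
    rw [← Real.rpow_natCast, ← Real.rpow_add ht]; norm_num
  have := ((h1.add h2).sub (h3.const_mul_left η)).tendsto_div_nhds_zero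
  refine this.congr fun t => ?_
  rw [Real.exp_neg, div_eq_mul_inv]
  rfl

theorem lineFactor_rigid {a b c m κ r₂ r₁ r₀ η : ℝ} (ha : 0 < a) (hm : 1 ≤ m)
    (h : Tendsto (lineFactor a b c m κ r₂ r₁ r₀ η) atTop (𝓝 0)) :
    η = 0 ∧ r₂ = 0 ∧ r₁ = 0 ∧
      ∀ᶠ t in atTop, lineFactor a b c m κ r₂ r₁ r₀ η t = 0 := by
  have hQ := tendsto_quadratic_atTop ha b c
  have htinv : Tendsto (fun t : ℝ => t⁻¹) atTop (𝓝 0) := tendsto_inv_atTop_zero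
  have hquad : ∀ p q r : ℝ, Tendsto (fun t : ℝ => p + q * t⁻¹ + r * t⁻¹ ^ 2) atTop (𝓝 p) := by
    intro p q r
    simpa using ((htinv.const_mul q).const_add p).add ((htinv.pow 2).const_mul r)
  have hratio : Tendsto (fun t : ℝ => (r₂ * t ^ 2 + r₁ * t + r₀) / (a * t ^ 2 + b * t + c))
      atTop (𝓝 (r₂ / a)) := by
    refine ((hquad r₂ r₁ r₀).div (hquad a b c) ha.ne').congr' ?_
    filter_upwards [eventually_gt_atTop 0, hQ.eventually_gt_atTop 0] with t ht hq
    have : a + b * t⁻¹ + c * t⁻¹ ^ 2 = (a * t ^ 2 + b * t + c) / t ^ 2 := by field_simp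
    have h' : r₂ + r₁ * t⁻¹ + r₀ * t⁻¹ ^ 2 = (r₂ * t ^ 2 + r₁ * t + r₀) / t ^ 2 := by
      field_simp
    rw [Pi.div_apply, this, h', div_div_div_cancel_right₀ (by positivity)]
  have hpowinv : Tendsto (fun t : ℝ => ((a * t ^ 2 + b * t + c) ^ m)⁻¹) atTop (𝓝 0) :=
    ((tendsto_rpow_atTop (by linarith)).comp hQ).inv_tendsto_atTop
  have hloginv : Tendsto (fun t : ℝ => (Real.log (a * t ^ 2 + b * t + c))⁻¹) atTop (𝓝 0) :=
    (Real.tendsto_log_atTop.comp hQ).inv_tendsto_atTop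
  have hη : η = 0 := by
    have h1 : Tendsto (fun t : ℝ =>
        (κ - lineFactor a b c m κ r₂ r₁ r₀ η t) * ((a * t ^ 2 + b * t + c) ^ m)⁻¹
            * (Real.log (a * t ^ 2 + b * t + c))⁻¹
          + (r₂ * t ^ 2 + r₁ * t + r₀) / (a * t ^ 2 + b * t + c)
            * (Real.log (a * t ^ 2 + b * t + c))⁻¹) atTop (𝓝 0) := by
      simpa using (((h.const_sub κ).mul hpowinv).mul hloginv).add (hratio.mul hloginv)
    refine tendsto_nhds_unique (tendsto_const_nhds.congr' ?_) h1
    filter_upwards [hQ.eventually_gt_atTop 1] with t hq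
    unfold lineFactor
    generalize a * t ^ 2 + b * t + c = X at *
    have hX : 0 < X := by linarith
    have hlog : Real.log X ≠ 0 := (Real.log_pos hq).ne'
    have hXm : X ^ m = X ^ (m - 1) * X := by
      rw [← Real.rpow_add_one hX.ne']; ring_nf
    have hXm1 : X ^ (m - 1) ≠ 0 := (Real.rpow_pos_of_pos hX _).ne'
    rw [hXm]
    field_simp
    ring
  subst hη
  have hR : (fun t : ℝ => r₂ * t ^ 2 + r₁ * t + r₀) =O[atTop] fun _ => (1 : ℝ) := by
    have hb := (h.sub_const κ).isBigO_one ℝ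
    refine IsBigO.trans (IsBigO.of_bound 1 ?_) hb
    filter_upwards [hQ.eventually_ge_atTop 1] with t hq
    have := Real.one_le_rpow hq (show 0 ≤ m - 1 by linarith)
    simp only [lineFactor, zero_mul, sub_zero, add_sub_cancel_left, norm_mul, one_mul]
    rw [Real.norm_of_nonneg (by linarith : 0 ≤ (a * t ^ 2 + b * t + c) ^ (m - 1))]
    exact le_mul_of_one_le_left (norm_nonneg _) this
  have hdiv : ∀ n : ℕ, n ≠ 0 →
      Tendsto (fun t : ℝ => (r₂ * t ^ 2 + r₁ * t + r₀) / t ^ n) atTop (𝓝 0) := by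
    intro n hn
    refine (hR.trans_isLittleO (isLittleO_const_left.2 (Or.inr ?_))).tendsto_div_nhds_zero
    exact tendsto_norm_atTop_atTop.comp (tendsto_pow_atTop hn)
  have hr₂ : r₂ = 0 := by
    refine tendsto_nhds_unique ((hquad r₂ r₁ r₀).congr' ?_) (hdiv 2 two_ne_zero)
    filter_upwards [eventually_gt_atTop 0] with t ht
    field_simp
  subst hr₂
  have hr₁ : r₁ = 0 := by
    refine tendsto_nhds_unique ((hquad r₁ r₀ 0).congr' ?_) (hdiv 1 one_ne_zero)
    filter_upwards [eventually_gt_atTop 0] with t ht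
    field_simp
    ring
  subst hr₁
  refine ⟨rfl, rfl, rfl, ?_⟩
  rcases hm.eq_or_lt with rfl | hm1
  · have h0 : κ + r₀ = 0 :=
      tendsto_nhds_unique (tendsto_const_nhds.congr fun t => by simp [lineFactor]) h
    exact Eventually.of_forall fun t => by simp [lineFactor, h0]
  · have hinv : Tendsto (fun t : ℝ => ((a * t ^ 2 + b * t + c) ^ (m - 1))⁻¹) atTop (𝓝 0) :=
      ((tendsto_rpow_atTop (sub_pos.2 hm1)).comp hQ).inv_tendsto_atTop
    have hr₀ : r₀ = 0 := by
      have h1 : Tendsto (fun t : ℝ => (lineFactor a b c m κ 0 0 r₀ 0 t - κ)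
          * ((a * t ^ 2 + b * t + c) ^ (m - 1))⁻¹) atTop (𝓝 0) := by
        simpa using (h.sub_const κ).mul hinv
      refine tendsto_nhds_unique (tendsto_const_nhds.congr' ?_) h1
      filter_upwards [hQ.eventually_gt_atTop 0] with t hq
      have := (Real.rpow_pos_of_pos hq (m - 1)).ne'
      simp only [lineFactor, zero_mul, sub_zero, zero_add, add_sub_cancel_left]
      rw [mul_comm, inv_mul_cancel_left₀ this]
    subst hr₀
    have h0 : κ = 0 :=
      tendsto_nhds_unique (tendsto_const_nhds.congr fun t => by simp [lineFactor]) h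
    exact Eventually.of_forall fun t => by simp [lineFactor, h0]

theorem eventually_lineFactor_eq_zero {ι : Type*} [Fintype ι]
    (a b c m κ r₂ r₁ r₀ η : ι → ℝ) (ha : ∀ j, 0 < a j) (hm : ∀ j, 1 ≤ m j)
    (hinj : ∀ i j, m i = m j → a i = a j → b i = b j → i = j)
    (hsum : ∀ t : ℝ, ∑ j, lineFactor (a j) (b j) (c j) (m j) (κ j) (r₂ j) (r₁ j) (r₀ j) (η j) t
      * Real.exp (-((a j * t ^ 2 + b j * t + c j) ^ m j)) = 0) (j : ι) :
    η j = 0 ∧ r₂ j = 0 ∧ r₁ j = 0 ∧ ∀ᶠ t in atTop,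
      lineFactor (a j) (b j) (c j) (m j) (κ j) (r₂ j) (r₁ j) (r₀ j) (η j) t = 0 := by
  classical
  set P : ι → ℝ → ℝ := fun j =>
    lineFactor (a j) (b j) (c j) (m j) (κ j) (r₂ j) (r₁ j) (r₀ j) (η j) with hP
  set E : ι → ℝ → ℝ := fun j t => (a j * t ^ 2 + b j * t + c j) ^ m j with hE
  suffices hzero : ∀ j, ∀ᶠ t in atTop, P j t = 0 from
    lineFactor_rigid (ha j) (hm j)
      (tendsto_const_nhds.congr' ((hzero j).mono fun t ht => ht.symm))
  by_contra! hne
  set S : Finset ι := {j | ¬ ∀ᶠ t in atTop, P j t = 0} with hS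
  have hSne : S.Nonempty := by
    obtain ⟨j, hj⟩ := hne
    exact ⟨j, Finset.mem_filter_univ j |>.2 (not_eventually.2 hj)⟩
  obtain ⟨j, hjS, hmin⟩ := S.exists_min_image
    (fun j => toLex (m j, toLex (a j, b j))) hSne
  have hterm : ∀ i ∈ Finset.univ.erase j,
      Tendsto (fun t => P i t * Real.exp (-(E i t - E j t))) atTop (𝓝 0) := by
    intro i hi
    by_cases hiS : i ∈ S
    · have hle := hmin i hiS
      have hij : i ≠ j := Finset.ne_of_mem_erase hi
      have hlex : m j < m i ∨ m j = m i ∧ (a j < a i ∨ a j = a i ∧ b j < b i) := by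
        simp only [Prod.Lex.le_iff, ofLex_toLex] at hle
        rcases hle with h | ⟨h, h' | ⟨h', h''⟩⟩
        · exact Or.inl h
        · exact Or.inr ⟨h, Or.inl h'⟩
        · refine Or.inr ⟨h, Or.inr ⟨h', h''.lt_of_ne fun e => hij ?_⟩⟩
          exact (hinj j i h h' e).symm
      obtain ⟨ε, hε, hgap⟩ := exists_linear_gap (c := c j) (c' := c i) (ha j) (ha i) (hm j) hlex
      have hdecay : Tendsto (fun t => P i t * Real.exp (-(ε * t))) atTop (𝓝 0) :=
        tendsto_lineFactor_mul_exp (ha i) (hm i) hε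
      refine squeeze_zero_norm' ?_ (tendsto_zero_iff_norm_tendsto_zero.1 hdecay)
      filter_upwards [hgap] with t ht
      rw [norm_mul, norm_mul, Real.norm_of_nonneg (Real.exp_nonneg _),
        Real.norm_of_nonneg (Real.exp_nonneg _)]
      gcongr
    · have : ∀ᶠ t in atTop, P i t = 0 := by
        simpa only [hS, Finset.mem_filter_univ, not_not] using hiS
      refine tendsto_const_nhds.congr' (this.mono fun t ht => ?_)
      simp only [ht, zero_mul]
  have hlim : Tendsto (P j) atTop (𝓝 0) := by
    have h := (tendsto_finsetSum _ hterm).neg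
    rw [Finset.sum_const_zero, neg_zero] at h
    refine h.congr fun t => ?_
    have hs : ∑ i, P i t * Real.exp (-(E i t - E j t)) = 0 := by
      have : ∀ i, P i t * Real.exp (-(E i t - E j t))
          = P i t * Real.exp (-(E i t)) * Real.exp (E j t) := fun i => by
        rw [mul_assoc, ← Real.exp_add]; ring_nf
      simp_rw [this, ← Finset.sum_mul]
      rw [hsum t, zero_mul]
    rw [← Finset.add_sum_erase _ _ (Finset.mem_univ j)] at hs
    simp only [sub_self, neg_zero, Real.exp_zero, mul_one] at hs
    linarith
  exact (Finset.mem_filter.1 hjS).2 (lineFactor_rigid (ha j) (hm j) hlim).2.2.2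

end Asymptotics

section LinearAlgebra

variable {d : ℕ}

theorem Matrix.IsSymm.dotProduct_mulVec_comm {W : Mat d} (hW : W.IsSymm) (p q : Vec d) :
    p ⬝ᵥ (W *ᵥ q) = q ⬝ᵥ (W *ᵥ p) := by
  rw [dotProduct_mulVec, ← mulVec_transpose, hW.eq, dotProduct_comm]

theorem Matrix.IsSymm.quadratic_add_smul {W : Mat d} (hW : W.IsSymm) (p q : Vec d) (t : ℝ) :
    (p + t • q) ⬝ᵥ (W *ᵥ (p + t • q))
      = (q ⬝ᵥ (W *ᵥ q)) * t ^ 2 + 2 * (p ⬝ᵥ (W *ᵥ q)) * t + p ⬝ᵥ (W *ᵥ p) := by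
  simp only [mulVec_add, mulVec_smul, dotProduct_add, add_dotProduct, dotProduct_smul,
    smul_dotProduct, smul_eq_mul, hW.dotProduct_mulVec_comm q p]
  ring

theorem Matrix.IsSymm.eq_zero_of_quadratic_eq_zero {W : Mat d} (hW : W.IsSymm)
    (h : ∀ u : Vec d, u ⬝ᵥ (W *ᵥ u) = 0) : W = 0 := by
  ext i j
  have := hW.quadratic_add_smul (Pi.single i 1) (Pi.single j 1) 1
  simp only [h] at this
  simp at this
  simpa using this

theorem Matrix.PosDef.isSymm_inv {M : Mat d} (hM : M.PosDef) : (M⁻¹).IsSymm := by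
  have := hM.inv.isHermitian
  rwa [IsHermitian, conjTranspose_eq_transpose_of_trivial] at this

theorem Matrix.IsSymm.inv_conj {M γ : Mat d} (hγ : γ.IsSymm) (hM : M.PosDef) :
    (M⁻¹ * γ * M⁻¹).IsSymm := by
  rw [IsSymm, transpose_mul, transpose_mul, hM.isSymm_inv.eq, hγ.eq, Matrix.mul_assoc]

end LinearAlgebra

section Density

variable {d : ℕ}

theorem isOpen_dense_setOf_forall_ne_zero {ι : Type*} [Finite ι] (p : ι → Prop)
    (g : ι → Vec d → ℝ) (hg : ∀ i, AnalyticOnNhd ℝ (g i) Set.univ)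
    (hne : ∀ i, p i → ∃ u, g i u ≠ 0) :
    IsOpen {u | ∀ i, p i → g i u ≠ 0} ∧ Dense {u | ∀ i, p i → g i u ≠ 0} := by
  have heq : {u | ∀ i, p i → g i u ≠ 0} = ⋂ i : {i // p i}, {u | g i u ≠ 0} := by
    ext; simp
  have hopen : ∀ i : {i // p i}, IsOpen {u | g i u ≠ 0} := fun i =>
    isOpen_ne_fun (hg i).continuous continuous_const
  rw [heq]
  refine ⟨isOpen_iInter_of_finite hopen, dense_iInter_of_isOpen hopen fun i => ?_⟩
  have hcompl : {u | g i u ≠ 0} = {u | g i u = 0}ᶜ := rfl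
  rw [hcompl, ← interior_eq_empty_iff_dense_compl, Set.eq_empty_iff_forall_notMem]
  intro u hu
  obtain ⟨v, hv⟩ := hne i i.2
  exact hv (congrFun ((hg i).eq_of_eventuallyEq (g := 0) analyticOnNhd_const
    (mem_interior_iff_mem_nhds.1 hu)) v)

theorem analyticOnNhd_quadratic (A : Mat d) :
    AnalyticOnNhd ℝ (fun u : Vec d => u ⬝ᵥ (A *ᵥ u)) Set.univ := by
  have : ContDiff ℝ ⊤ (fun u : Vec d => u ⬝ᵥ (A *ᵥ u)) := by
    unfold Matrix.mulVec dotProduct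
    fun_prop
  exact this.analyticOnNhd

theorem analyticOnNhd_dotProduct (v : Vec d) :
    AnalyticOnNhd ℝ (fun u : Vec d => u ⬝ᵥ v) Set.univ := by
  have : ContDiff ℝ ⊤ (fun u : Vec d => u ⬝ᵥ v) := by
    unfold dotProduct
    fun_prop
  exact this.analyticOnNhd

end Density

section Derivatives

variable {d : ℕ}

def normConst (d : ℕ) (M : Mat d) (m : ℝ) : ℝ :=
  (m * Real.Gamma ((d : ℝ) / 2)) /
    (Real.pi ^ ((d : ℝ) / 2) * Real.Gamma ((d : ℝ) / (2 * m)) * Real.sqrt M.det)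

def mahalanobisSq (θ : Vec d) (M : Mat d) (x : Vec d) : ℝ :=
  (x - θ) ⬝ᵥ (M⁻¹ *ᵥ (x - θ))

theorem mvGenGauss_eq (θ : Vec d) (M : Mat d) (m : ℝ) (x : Vec d) :
    mvGenGauss d θ M m x = normConst d M m * Real.exp (-(mahalanobisSq θ M x ^ m)) := rfl

theorem mahalanobisSq_nonneg {M : Mat d} (hM : M.PosDef) (θ x : Vec d) :
    0 ≤ mahalanobisSq θ M x := by
  simpa [mahalanobisSq] using hM.inv.posSemidef.dotProduct_mulVec_nonneg (x - θ)

theorem normConst_pos (hd : 1 ≤ d) {M : Mat d} (hM : M.PosDef) {m : ℝ} (hm : 1 ≤ m) :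
    0 < normConst d M m := by
  have hd' : (0 : ℝ) < d := by exact_mod_cast hd
  have hm' : 0 < m := by linarith
  have := hM.det_pos
  have := Real.Gamma_pos_of_pos (show (0 : ℝ) < d / 2 by positivity)
  have := Real.Gamma_pos_of_pos (show (0 : ℝ) < d / (2 * m) by positivity)
  unfold normConst
  positivity

theorem differentiableAt_normConst_shape (hd : 1 ≤ d) {M : Mat d} (hM : M.PosDef) {m : ℝ}
    (hm : 1 ≤ m) : DifferentiableAt ℝ (fun s => normConst d M s) m := by
  have hd' : (0 : ℝ) < d := by exact_mod_cast hd
  have hpos : (0 : ℝ) < d / (2 * m) := by positivity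
  have hG : DifferentiableAt ℝ Real.Gamma (d / (2 * m)) := by
    refine Real.differentiableAt_Gamma fun n => ?_
    have : (0 : ℝ) ≤ n := n.cast_nonneg
    linarith
  have hG' : DifferentiableAt ℝ (fun s : ℝ => Real.Gamma (d / (2 * s))) m :=
    DifferentiableAt.comp m (f := fun s : ℝ => (d : ℝ) / (2 * s)) hG
      ((differentiableAt_const _).div (by fun_prop) (by positivity))
  have hdet := hM.det_pos
  have := Real.Gamma_pos_of_pos hpos
  exact (differentiableAt_id.mul_const _).div ((hG'.const_mul _).mul_const _) (by positivity)

theorem differentiableAt_normConst_matrix (hd : 1 ≤ d) {M : Mat d} (hM : M.PosDef) (γ : Mat d)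
    {m : ℝ} (hm : 1 ≤ m) : DifferentiableAt ℝ (fun t : ℝ => normConst d (M + t • γ) m) 0 := by
  have hd' : (0 : ℝ) < d := by exact_mod_cast hd
  have hdet := hM.det_pos
  have hD : DifferentiableAt ℝ (fun t : ℝ => (M + t • γ).det) 0 := by
    simp only [det_apply, Matrix.add_apply, Matrix.smul_apply, smul_eq_mul]
    simp only [Units.smul_def, zsmul_eq_mul]
    fun_prop
  have := Real.Gamma_pos_of_pos (show (0 : ℝ) < d / (2 * m) by positivity)
  refine (differentiableAt_const _).div ((hD.sqrt ?_).const_mul _) ?_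
  · simpa using hdet.ne'
  · simp only [zero_smul, add_zero]
    positivity

theorem hasDerivAt_mahalanobisSq_location {M : Mat d} (hM : M.PosDef) (θ β x : Vec d) :
    HasDerivAt (fun t : ℝ => mahalanobisSq (θ + t • β) M x)
      (-(2 * ((x - θ) ⬝ᵥ (M⁻¹ *ᵥ β)))) 0 := by
  have h : ∀ t : ℝ, mahalanobisSq (θ + t • β) M x = (β ⬝ᵥ (M⁻¹ *ᵥ β)) * t ^ 2
      - 2 * ((x - θ) ⬝ᵥ (M⁻¹ *ᵥ β)) * t + (x - θ) ⬝ᵥ (M⁻¹ *ᵥ (x - θ)) := by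
    intro t
    have hx : x - (θ + t • β) = (x - θ) + t • (-β) := by module
    rw [mahalanobisSq, hx, hM.isSymm_inv.quadratic_add_smul]
    simp [mulVec_neg]
    ring
  simp_rw [h]
  have := ((((hasDerivAt_id (0 : ℝ)).pow 2).const_mul (β ⬝ᵥ (M⁻¹ *ᵥ β))).sub
    ((hasDerivAt_id (0 : ℝ)).const_mul (2 * ((x - θ) ⬝ᵥ (M⁻¹ *ᵥ β))))).add_const
      ((x - θ) ⬝ᵥ (M⁻¹ *ᵥ (x - θ)))
  simpa using this

section

attribute [local instance] Matrix.linftyOpNormedRing Matrix.linftyOpNormedAlgebra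

theorem hasDerivAt_mahalanobisSq_matrix {M : Mat d} (hM : M.PosDef) (γ : Mat d)
    (θ x : Vec d) :
    HasDerivAt (fun t : ℝ => mahalanobisSq θ (M + t • γ) x)
      (-((x - θ) ⬝ᵥ ((M⁻¹ * γ * M⁻¹) *ᵥ (x - θ)))) 0 := by
  obtain ⟨U, hU⟩ := hM.isUnit
  have hUinv : (↑U⁻¹ : Mat d) = M⁻¹ := by rw [← hU, Matrix.coe_units_inv]
  have hline : HasDerivAt (fun t : ℝ => M + t • γ) γ 0 := by
    exact (((hasDerivAt_id (0 : ℝ)).smul_const γ).const_add M).congr_deriv (one_smul ℝ γ)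
  have hinv : HasFDerivAt Ring.inverse
      (-ContinuousLinearMap.mulLeftRight ℝ (Mat d) M⁻¹ M⁻¹) (M + (0 : ℝ) • γ) := by
    rw [zero_smul, add_zero, ← hUinv, ← hU]
    exact hasFDerivAt_ringInverse U
  have hcomp := hinv.comp_hasDerivAt (0 : ℝ) hline
  let L : Mat d →ₗ[ℝ] ℝ :=
    { toFun := fun A => (x - θ) ⬝ᵥ (A *ᵥ (x - θ))
      map_add' := fun A B => by rw [add_mulVec, dotProduct_add]
      map_smul' := fun r A => by rw [smul_mulVec, dotProduct_smul]; rfl }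
  have := (LinearMap.toContinuousLinearMap L).hasFDerivAt.comp_hasDerivAt (0 : ℝ) hcomp
  refine (this.congr_deriv ?_).congr_of_eventuallyEq (Eventually.of_forall fun t => ?_)
  · change (x - θ) ⬝ᵥ ((-(M⁻¹ * γ * M⁻¹)) *ᵥ (x - θ)) = _
    rw [neg_mulVec, dotProduct_neg]
  · simp only [mahalanobisSq, nonsing_inv_eq_ringInverse]
    rfl

end

theorem hasDerivAt_rpow_shape {Q : ℝ} (hQ : 0 ≤ Q) {m : ℝ} (hm : 1 ≤ m) :
    HasDerivAt (fun s : ℝ => Q ^ s) (Q ^ m * Real.log Q) m := by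
  rcases hQ.eq_or_lt with rfl | hQ
  · rw [Real.log_zero, mul_zero]
    refine (hasDerivAt_const m (0 : ℝ)).congr_of_eventuallyEq ?_
    filter_upwards [lt_mem_nhds (show 0 < m by linarith)] with s hs
    exact Real.zero_rpow hs.ne'
  · exact (Real.hasStrictDerivAt_const_rpow hQ m).hasDerivAt

theorem dThetaG_eq {M : Mat d} (hM : M.PosDef) {m : ℝ} (hm : 1 ≤ m) (θ β x : Vec d) :
    dThetaG d θ M m β x = normConst d M m * (2 * m * mahalanobisSq θ M x ^ (m - 1)
      * ((x - θ) ⬝ᵥ (M⁻¹ *ᵥ β))) * Real.exp (-(mahalanobisSq θ M x ^ m)) := by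
  have h := (((hasDerivAt_mahalanobisSq_location hM θ β x).rpow_const
    (Or.inr hm)).neg.exp).const_mul (normConst d M m)
  refine h.deriv.trans ?_
  simp only [zero_smul, add_zero, Pi.neg_apply]
  ring

theorem dSigmaG_eq (hd : 1 ≤ d) {M : Mat d} (hM : M.PosDef) {m : ℝ} (hm : 1 ≤ m)
    (γ : Mat d) (θ x : Vec d) :
    dSigmaG d θ M m γ x = (deriv (fun t : ℝ => normConst d (M + t • γ) m) 0
      + normConst d M m * (m * mahalanobisSq θ M x ^ (m - 1)
      * ((x - θ) ⬝ᵥ ((M⁻¹ * γ * M⁻¹) *ᵥ (x - θ)))))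
      * Real.exp (-(mahalanobisSq θ M x ^ m)) := by
  have h := (differentiableAt_normConst_matrix hd hM γ hm).hasDerivAt.mul
    ((hasDerivAt_mahalanobisSq_matrix hM γ θ x).rpow_const (p := m) (Or.inr hm)).neg.exp
  refine h.deriv.trans ?_
  simp only [zero_smul, add_zero, Pi.neg_apply]
  ring

theorem dShapeG_eq (hd : 1 ≤ d) {M : Mat d} (hM : M.PosDef) {m : ℝ} (hm : 1 ≤ m)
    (θ x : Vec d) :
    dShapeG d θ M m x = (deriv (fun s : ℝ => normConst d M s) m
      - normConst d M m * (mahalanobisSq θ M x ^ m * Real.log (mahalanobisSq θ M x)))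
      * Real.exp (-(mahalanobisSq θ M x ^ m)) := by
  have h := (differentiableAt_normConst_shape hd hM hm).hasDerivAt.mul
    (hasDerivAt_rpow_shape (mahalanobisSq_nonneg hM θ x) hm).neg.exp
  refine h.deriv.trans ?_
  simp only [Pi.neg_apply]
  ring

end Derivatives

/-- The first-order perturbation of one component, divided by its exponential factor. -/
def firstOrderFactor {d : ℕ} (θ : Vec d) (M : Mat d) (m α : ℝ) (β : Vec d) (γ : Mat d) (η : ℝ)
    (x : Vec d) : ℝ :=
  (α * normConst d M m + deriv (fun t : ℝ => normConst d (M + t • γ) m) 0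
      + η * deriv (fun s : ℝ => normConst d M s) m)
    + mahalanobisSq θ M x ^ (m - 1) * (normConst d M m * m *
      (2 * ((x - θ) ⬝ᵥ (M⁻¹ *ᵥ β)) + (x - θ) ⬝ᵥ ((M⁻¹ * γ * M⁻¹) *ᵥ (x - θ))))
    - η * normConst d M m * (mahalanobisSq θ M x ^ m * Real.log (mahalanobisSq θ M x))

section FirstOrder

variable {d : ℕ}

theorem firstOrder_eq (hd : 1 ≤ d) {M : Mat d} (hM : M.PosDef) {m : ℝ} (hm : 1 ≤ m)
    (θ : Vec d) (α : ℝ) (β : Vec d) (γ : Mat d) (η : ℝ) (x : Vec d) :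
    α * mvGenGauss d θ M m x + dThetaG d θ M m β x + dSigmaG d θ M m γ x
        + η * dShapeG d θ M m x
      = firstOrderFactor θ M m α β γ η x * Real.exp (-(mahalanobisSq θ M x ^ m)) := by
  rw [mvGenGauss_eq, dThetaG_eq hM hm, dSigmaG_eq hd hM hm, dShapeG_eq hd hM hm,
    firstOrderFactor]
  ring

theorem continuous_mahalanobisSq (θ : Vec d) (M : Mat d) : Continuous (mahalanobisSq θ M) := by
  unfold mahalanobisSq
  fun_prop

theorem continuous_rpow_mul_log {m : ℝ} (hm : 1 ≤ m) :
    Continuous fun q : ℝ => q ^ m * Real.log q := by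
  have h : (fun q : ℝ => q ^ m * Real.log q) = fun q => q ^ (m - 1) * (q * Real.log q) := by
    ext q
    rcases eq_or_ne q 0 with rfl | hq
    · simp
    · rw [← mul_assoc, ← Real.rpow_add_one hq, sub_add_cancel]
  rw [h]
  exact (Real.continuous_rpow_const (by linarith)).mul Real.continuous_mul_log

theorem continuous_firstOrderFactor {m : ℝ} (hm : 1 ≤ m) (θ : Vec d) (M : Mat d) (α : ℝ)
    (β : Vec d) (γ : Mat d) (η : ℝ) : Continuous (firstOrderFactor θ M m α β γ η) := by
  have hQ := continuous_mahalanobisSq θ M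
  have h1 := (Real.continuous_rpow_const (show 0 ≤ m - 1 by linarith)).comp hQ
  have h2 := (continuous_rpow_mul_log hm).comp hQ
  unfold firstOrderFactor
  refine (continuous_const.add (h1.mul ?_)).sub (continuous_const.mul h2)
  fun_prop

theorem mahalanobisSq_smul {M : Mat d} (hM : M.PosDef) (θ u : Vec d) (t : ℝ) :
    mahalanobisSq θ M (t • u) = (u ⬝ᵥ (M⁻¹ *ᵥ u)) * t ^ 2
      + (-(2 * (u ⬝ᵥ (M⁻¹ *ᵥ θ)))) * t + θ ⬝ᵥ (M⁻¹ *ᵥ θ) := by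
  have hx : t • u - θ = -θ + t • u := by abel
  rw [mahalanobisSq, hx, hM.isSymm_inv.quadratic_add_smul]
  simp [mulVec_neg, hM.isSymm_inv.dotProduct_mulVec_comm θ u]

theorem firstOrderFactor_smul {M : Mat d} (hM : M.PosDef) (m α : ℝ) (θ β : Vec d)
    {γ : Mat d} (hγ : γ.IsSymm) (η : ℝ) (u : Vec d) (t : ℝ) :
    firstOrderFactor θ M m α β γ η (t • u) = lineFactor (u ⬝ᵥ (M⁻¹ *ᵥ u))
      (-(2 * (u ⬝ᵥ (M⁻¹ *ᵥ θ)))) (θ ⬝ᵥ (M⁻¹ *ᵥ θ)) m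
      (α * normConst d M m + deriv (fun t : ℝ => normConst d (M + t • γ) m) 0
        + η * deriv (fun s : ℝ => normConst d M s) m)
      (normConst d M m * m * (u ⬝ᵥ ((M⁻¹ * γ * M⁻¹) *ᵥ u)))
      (normConst d M m * m * (2 * (u ⬝ᵥ (M⁻¹ *ᵥ β))
        - 2 * (u ⬝ᵥ ((M⁻¹ * γ * M⁻¹) *ᵥ θ))))
      (normConst d M m * m * (θ ⬝ᵥ ((M⁻¹ * γ * M⁻¹) *ᵥ θ) - 2 * (θ ⬝ᵥ (M⁻¹ *ᵥ β))))
      (η * normConst d M m) t := by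
  have hG := hγ.inv_conj hM
  have hx : t • u - θ = -θ + t • u := by abel
  have hβ : (t • u - θ) ⬝ᵥ (M⁻¹ *ᵥ β) = t * (u ⬝ᵥ (M⁻¹ *ᵥ β)) - θ ⬝ᵥ (M⁻¹ *ᵥ β) := by
    rw [sub_dotProduct, smul_dotProduct, smul_eq_mul]
  rw [firstOrderFactor, lineFactor, ← mahalanobisSq_smul hM, hβ, hx, hG.quadratic_add_smul]
  simp only [mulVec_neg, dotProduct_neg, neg_dotProduct, neg_neg,
    hG.dotProduct_mulVec_comm θ u]
  ring

end FirstOrder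

section Genericity

variable {d k : ℕ}

theorem posDef_inv_injective {M N : Mat d} (hM : M.PosDef) (hN : N.PosDef)
    (h : M⁻¹ = N⁻¹) : M = N := by
  rw [← nonsing_inv_nonsing_inv M ((isUnit_iff_isUnit_det M).1 hM.isUnit), h,
    nonsing_inv_nonsing_inv N ((isUnit_iff_isUnit_det N).1 hN.isUnit)]

theorem inv_mulVec_injective {M : Mat d} (hM : M.PosDef) :
    Function.Injective fun v : Vec d => M⁻¹ *ᵥ v :=
  mulVec_injective_iff_isUnit.2 hM.inv.isUnit

/-- Nonzero directions along which the quadratic polynomials `t ↦ (t u - θ)ᵀ Σ⁻¹ (t u - θ)`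
of components with equal shapes differ in one of the two leading coefficients. -/
def genericDirections (φ : Fin k → Vec d × Mat d × ℝ) : Set (Vec d) :=
  {u | u ≠ 0 ∧ ∀ i j, (φ i).2.2 = (φ j).2.2 →
    u ⬝ᵥ ((φ i).2.1⁻¹ *ᵥ u) = u ⬝ᵥ ((φ j).2.1⁻¹ *ᵥ u) →
    u ⬝ᵥ ((φ i).2.1⁻¹ *ᵥ (φ i).1) = u ⬝ᵥ ((φ j).2.1⁻¹ *ᵥ (φ j).1) → i = j}

theorem dense_genericDirections (hd : 1 ≤ d) {φ : Fin k → Vec d × Mat d × ℝ}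
    (hφ : ∀ j, (φ j).2.1.PosDef) (hinj : Function.Injective φ) :
    Dense (genericDirections φ) := by
  have : Nonempty (Fin d) := ⟨⟨0, hd⟩⟩
  obtain ⟨hopen₁, hdense₁⟩ := isOpen_dense_setOf_forall_ne_zero (ι := Fin k × Fin k)
    (fun p => (φ p.1).2.1 ≠ (φ p.2).2.1)
    (fun p u => u ⬝ᵥ (((φ p.1).2.1⁻¹ - (φ p.2).2.1⁻¹) *ᵥ u))
    (fun p => analyticOnNhd_quadratic _) (fun p hp => by
      by_contra! h
      have := ((hφ p.1).isSymm_inv.sub (hφ p.2).isSymm_inv).eq_zero_of_quadratic_eq_zero h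
      exact hp (posDef_inv_injective (hφ _) (hφ _) (sub_eq_zero.1 this)))
  obtain ⟨hopen₂, hdense₂⟩ := isOpen_dense_setOf_forall_ne_zero (ι := Fin k × Fin k)
    (fun p => (φ p.1).2.1⁻¹ *ᵥ (φ p.1).1 ≠ (φ p.2).2.1⁻¹ *ᵥ (φ p.2).1)
    (fun p u => u ⬝ᵥ ((φ p.1).2.1⁻¹ *ᵥ (φ p.1).1 - (φ p.2).2.1⁻¹ *ᵥ (φ p.2).1))
    (fun p => analyticOnNhd_dotProduct _)
    (fun p hp => ⟨_, mt dotProduct_self_eq_zero.1 (sub_ne_zero.2 hp)⟩)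
  refine ((hdense₁.inter_of_isOpen_left hdense₂ hopen₁).inter_of_isOpen_left
    (dense_compl_singleton 0) (hopen₁.inter hopen₂)).mono ?_
  rintro u ⟨⟨h₁, h₂⟩, h₀⟩
  refine ⟨h₀, fun i j hm ha hb => hinj ?_⟩
  have hM : (φ i).2.1 = (φ j).2.1 := by
    by_contra hne
    exact h₁ (i, j) hne (by simp only [sub_mulVec, dotProduct_sub, ha, sub_self])
  have hv : (φ i).2.1⁻¹ *ᵥ (φ i).1 = (φ j).2.1⁻¹ *ᵥ (φ j).1 := by
    by_contra hne
    exact h₂ (i, j) hne (by simp only [dotProduct_sub, hb, sub_self])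
  rw [hM] at hv
  exact Prod.ext (inv_mulVec_injective (hφ j) hv) (Prod.ext hM hm)

end Genericity

/-- **Theorem 3.4(a)**: the multivariate generalized Gaussian family
`{f(·|θ,Σ,m) : θ ∈ ℝ^d, Σ ∈ S_d^{++}, m ≥ 1}` is identifiable in the first order. -/
theorem mv_generalized_gaussian_first_order_identifiable
    (d : ℕ) (hd : 1 ≤ d) (k : ℕ) (hk : 1 ≤ k)
    (φ : Fin k → Vec d × Mat d × ℝ)
    (hφ : ∀ j, (φ j).2.1.PosDef ∧ 1 ≤ (φ j).2.2)
    (hinj : Function.Injective φ)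
    (α : Fin k → ℝ) (β : Fin k → Vec d) (γ : Fin k → Mat d) (η : Fin k → ℝ)
    (hγ : ∀ j, (γ j).IsSymm)
    (hae : ∀ᵐ x ∂(volume : Measure (Vec d)),
      ∑ j, (α j * mvGenGauss d (φ j).1 (φ j).2.1 (φ j).2.2 x
        + dThetaG d (φ j).1 (φ j).2.1 (φ j).2.2 (β j) x
        + dSigmaG d (φ j).1 (φ j).2.1 (φ j).2.2 (γ j) x
        + η j * dShapeG d (φ j).1 (φ j).2.1 (φ j).2.2 x) = 0) :
    ∀ j, α j = 0 ∧ β j = 0 ∧ γ j = 0 ∧ η j = 0 := by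
  have hpos : ∀ j, (φ j).2.1.PosDef := fun j => (hφ j).1
  have hshape : ∀ j, 1 ≤ (φ j).2.2 := fun j => (hφ j).2
  have hzero : ∀ x : Vec d, ∑ j, firstOrderFactor (φ j).1 (φ j).2.1 (φ j).2.2 (α j) (β j)
      (γ j) (η j) x * Real.exp (-(mahalanobisSq (φ j).1 (φ j).2.1 x ^ (φ j).2.2)) = 0 := by
    refine congrFun ((Continuous.ae_eq_iff_eq volume ?_ (continuous_const (y := 0))).1 ?_)
    · refine continuous_finsetSum _ fun j _ => ?_
      refine (continuous_firstOrderFactor (hshape j) _ _ _ _ _ _).mul ?_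
      exact ((Real.continuous_rpow_const (by linarith [hshape j])).comp
        (continuous_mahalanobisSq _ _)).neg.rexp
    · filter_upwards [hae] with x hx
      rw [← hx]
      exact Finset.sum_congr rfl fun j _ => (firstOrder_eq hd (hpos j) (hshape j) ..).symm
  have hline := fun (u : Vec d) (hu : u ∈ genericDirections φ) (j : Fin k) =>
    eventually_lineFactor_eq_zero _
      (fun j => -(2 * (u ⬝ᵥ ((φ j).2.1⁻¹ *ᵥ (φ j).1)))) _ _ _ _ _ _ _
      (fun j => by simpa using (hpos j).inv.dotProduct_mulVec_pos hu.1) hshape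
      (fun i j hm ha hb => hu.2 i j hm ha (by linarith))
      (fun t => by
        refine Eq.trans ?_ (hzero (t • u))
        refine Finset.sum_congr rfl fun j _ => ?_
        rw [firstOrderFactor_smul (hpos j) _ _ _ _ (hγ j), mahalanobisSq_smul (hpos j)]) j
  have hdense := dense_genericDirections hd hpos hinj
  obtain ⟨u₀, hu₀⟩ := hdense.nonempty
  intro j
  have hC := normConst_pos hd (hpos j) (hshape j)
  have hCm : normConst d (φ j).2.1 (φ j).2.2 * (φ j).2.2 ≠ 0 :=
    (mul_pos hC (by linarith [hshape j])).ne'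
  have hη0 : η j = 0 := (mul_eq_zero.1 (hline u₀ hu₀ j).1).resolve_right hC.ne'
  have hG : (φ j).2.1⁻¹ * γ j * (φ j).2.1⁻¹ = 0 := by
    refine ((hγ j).inv_conj (hpos j)).eq_zero_of_quadratic_eq_zero (congrFun
      (Continuous.ext_on hdense (analyticOnNhd_quadratic _).continuous
        (continuous_const (y := 0)) fun u hu => ?_))
    exact (mul_eq_zero.1 (hline u hu j).2.1).resolve_left hCm
  have hγ0 : γ j = 0 := by
    have hU := (hpos j).inv.isUnit
    exact hU.mul_right_eq_zero.1 (hU.mul_left_eq_zero.1 hG)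
  have hβ0 : β j = 0 := by
    have hdot : ∀ u : Vec d, u ⬝ᵥ ((φ j).2.1⁻¹ *ᵥ β j) = 0 := by
      refine congrFun (Continuous.ext_on hdense (analyticOnNhd_dotProduct _).continuous
        (continuous_const (y := 0)) fun u hu => ?_)
      have := (mul_eq_zero.1 (hline u hu j).2.2.1).resolve_left hCm
      simpa [hG] using this
    exact inv_mulVec_injective (hpos j)
      ((dotProduct_self_eq_zero.1 (hdot _)).trans (mulVec_zero _).symm)
  refine ⟨?_, hβ0, hγ0, hη0⟩
  obtain ⟨t, ht⟩ := (hline u₀ hu₀ j).2.2.2.exists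
  have : α j * normConst d (φ j).2.1 (φ j).2.2 = 0 := by
    simpa [lineFactor, hβ0, hγ0, hη0] using ht
  exact (mul_eq_zero.1 this).resolve_right hC.ne'
end
end

section
/- Solvability threshold of the Gaussian over-fitting polynomial system, two extra components (Proposition 4.2(ii)): For m = 3, the system S_{3,5} admits a nontrivial real solution, while the system S_{3,6} admits no nontrivial real solution. Equivalently, the smallest r ≥ 1 for which S_{3,r} has no nontrivial real solution is r̄(3) = 6. -/
noncomputable section

/-- The system `S_{m,r}` of `r` polynomial equations in the unknowns
`(c_j, a_j, b_j)_{j=1}^m`: for each `α ∈ {1,…,r}`,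
`∑_j ∑_{n₁+2n₂=α} c_j² a_j^{n₁} b_j^{n₂}/(n₁! n₂!) = 0`. -/
def SsysEq (m r : ℕ) (c a b : Fin m → ℝ) : Prop :=
  ∀ α : ℕ, 1 ≤ α → α ≤ r →
    ∑ j : Fin m, ∑ n ∈ Finset.filter (fun n : ℕ × ℕ => n.1 + 2 * n.2 = α)
        (Finset.range (α + 1) ×ˢ Finset.range (α + 1)),
      c j ^ 2 * a j ^ n.1 * b j ^ n.2 / (n.1.factorial * n.2.factorial : ℝ) = 0

/-- The system `S_{m,r}` admits a nontrivial real solution: all `c_j ≠ 0`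
and at least one `a_j ≠ 0`. -/
def NontrivSol (m r : ℕ) : Prop :=
  ∃ c a b : Fin m → ℝ, SsysEq m r c a b ∧ (∀ j, c j ≠ 0) ∧ (∃ j, a j ≠ 0)

section

/-- `AlternatesFrom f n x`: there are points `x = x₀ < x₁ < ⋯ < xₙ` at which the values of `f` are
nonzero and alternate in sign. -/
def AlternatesFrom (f : ℝ → ℝ) : ℕ → ℝ → Prop
  | 0, x => f x ≠ 0
  | n + 1, x => ∃ y, x < y ∧ f x * f y < 0 ∧ AlternatesFrom f n y

namespace AlternatesFrom

variable {f g : ℝ → ℝ}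

lemma ne_zero {n : ℕ} {x : ℝ} (h : AlternatesFrom f n x) : f x ≠ 0 := by
  cases n with
  | zero => exact h
  | succ n =>
    obtain ⟨y, -, hy, -⟩ := h
    rintro h0
    simp [h0] at hy

lemma map (h₀ : ∀ x, f x ≠ 0 → g x ≠ 0) (h₁ : ∀ x y, f x * f y < 0 → g x * g y < 0) {n : ℕ} :
    ∀ {x : ℝ}, AlternatesFrom f n x → AlternatesFrom g n x := by
  induction n with
  | zero => exact fun {x} h => h₀ x h
  | succ n ih =>
    rintro x ⟨y, hxy, hs, hy⟩
    exact ⟨y, hxy, h₁ _ _ hs, ih hy⟩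

lemma neg {n : ℕ} {x : ℝ} (h : AlternatesFrom f n x) : AlternatesFrom (fun x => -f x) n x :=
  h.map (fun _ h => neg_ne_zero.2 h) (fun x y h => by linarith [neg_mul_neg (f x) (f y)])

lemma of_mul_pos {w : ℝ → ℝ} (hw : ∀ x, 0 < w x) {n : ℕ} {x : ℝ}
    (h : AlternatesFrom (fun x => w x * f x) n x) : AlternatesFrom f n x :=
  h.map (fun _ h => right_ne_zero_of_mul h) (fun x y h => by
    have h' : (w x * w y) * (f x * f y) < 0 := by linarith
    exact (pos_iff_neg_of_mul_neg h').1 (mul_pos (hw x) (hw y)))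

lemma of_pos_iff (hpos : ∀ x, 0 < f x ↔ 0 < g x) (hneg : ∀ x, f x < 0 ↔ g x < 0) {n : ℕ} {x : ℝ}
    (h : AlternatesFrom f n x) : AlternatesFrom g n x := by
  refine h.map (fun x h => ?_) (fun x y h => ?_)
  · rcases h.lt_or_gt with h | h
    · exact ((hneg x).1 h).ne
    · exact ((hpos x).1 h).ne'
  · rcases mul_neg_iff.1 h with ⟨hx, hy⟩ | ⟨hx, hy⟩
    · exact mul_neg_of_pos_of_neg ((hpos x).1 hx) ((hneg y).1 hy)
    · exact mul_neg_of_neg_of_pos ((hneg x).1 hx) ((hpos y).1 hy)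

/-- Rolle's theorem for sign alternations. -/
lemma exists_deriv {f' : ℝ → ℝ} (hf : ∀ x, HasDerivAt f (f' x) x) {n : ℕ} :
    ∀ {x : ℝ}, AlternatesFrom f (n + 1) x →
      ∃ c, x < c ∧ f x * f' c < 0 ∧ AlternatesFrom f' n c := by
  have slope : ∀ x y, x < y → f x * f y < 0 → ∃ c, x < c ∧ c < y ∧ f x * f' c < 0 := by
    intro x y hxy hs
    obtain ⟨c, hc, hc'⟩ := exists_hasDerivAt_eq_slope f f' hxy
      (fun z _ => (hf z).continuousAt.continuousWithinAt) (fun z _ => hf z)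
    refine ⟨c, hc.1, hc.2, ?_⟩
    rw [hc', ← mul_div_assoc]
    exact div_neg_of_neg_of_pos (by nlinarith [sq_nonneg (f x)]) (sub_pos.2 hxy)
  induction n with
  | zero =>
    rintro x ⟨y, hxy, hs, -⟩
    obtain ⟨c, hxc, -, hc⟩ := slope x y hxy hs
    exact ⟨c, hxc, hc, right_ne_zero_of_mul hc.ne⟩
  | succ n ih =>
    rintro x ⟨y, hxy, hs, hy⟩
    obtain ⟨d, hyd, hd, hd'⟩ := ih hy
    obtain ⟨c, hxc, hcy, hc⟩ := slope x y hxy hs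
    refine ⟨c, hxc, hc, d, hcy.trans hyd, ?_, hd'⟩
    rcases mul_neg_iff.1 hs with ⟨h1, h2⟩ | ⟨h1, h2⟩
    · exact mul_neg_of_neg_of_pos ((pos_iff_neg_of_mul_neg hc).1 h1)
        ((neg_iff_pos_of_mul_neg hd).1 h2)
    · exact mul_neg_of_pos_of_neg ((neg_iff_pos_of_mul_neg hc).1 h1)
        ((pos_iff_neg_of_mul_neg hd).1 h2)

lemma deriv_of_forall_not {f' : ℝ → ℝ} (hf : ∀ x, HasDerivAt f (f' x) x) {n : ℕ}
    (h : ∀ x, ¬ AlternatesFrom f' n x) (x : ℝ) : ¬ AlternatesFrom f (n + 1) x := fun hx =>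
  let ⟨c, _, _, hc⟩ := exists_deriv hf hx
  h c hc

lemma not_of_nonneg (hf : ∀ x, 0 ≤ f x) {n : ℕ} (x : ℝ) : ¬ AlternatesFrom f (n + 1) x := by
  rintro ⟨y, -, hs, -⟩
  exact absurd hs (mul_nonneg (hf x) (hf y)).not_gt

lemma not_of_nonpos (hf : ∀ x, f x ≤ 0) {n : ℕ} (x : ℝ) : ¬ AlternatesFrom f (n + 1) x := by
  rintro ⟨y, -, hs, -⟩
  exact absurd hs (mul_nonneg_of_nonpos_of_nonpos (hf x) (hf y)).not_gt

open Polynomial in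
/-- A function with at most `n` sign alternations has the sign of a polynomial of degree at most
`n`. -/
theorem exists_polynomial {n : ℕ} : ∀ {f : ℝ → ℝ}, (∀ x, ¬ AlternatesFrom f (n + 1) x) →
    ∃ r : ℝ[X], r ≠ 0 ∧ r.natDegree ≤ n ∧ ∀ x, 0 ≤ r.eval x * f x := by
  induction n with
  | zero =>
    intro f hf
    have key : ∀ x y, 0 ≤ f x * f y := by
      intro x y
      by_contra! h
      rcases lt_trichotomy x y with hxy | rfl | hxy
      · exact hf x ⟨y, hxy, h, right_ne_zero_of_mul h.ne⟩
      · exact absurd h (mul_self_nonneg _).not_gt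
      · exact hf y ⟨x, hxy, by linarith [mul_comm (f x) (f y)], left_ne_zero_of_mul h.ne⟩
    by_cases hpos : ∃ x, 0 < f x
    · obtain ⟨x, hx⟩ := hpos
      exact ⟨1, one_ne_zero, by simp, fun y => by
        simpa using nonneg_of_mul_nonneg_right (key x y) hx⟩
    · push Not at hpos
      exact ⟨-1, by simp, by simp, fun y => by simpa using hpos y⟩
  | succ n ih =>
    intro f hf
    by_cases hn : ∀ x, ¬ AlternatesFrom f (n + 1) x
    · obtain ⟨r, h0, hd, hr⟩ := ih hn
      exact ⟨r, h0, by omega, hr⟩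
    push Not at hn
    obtain ⟨x₀, hx₀⟩ := hn
    set S : Set ℝ := {x | ∃ y, y < x ∧ f y * f x < 0} with hS
    have prepend : ∀ y, f y ≠ 0 → ∀ x ∈ S, x < y → ∃ z, z < y ∧ f z * f y < 0 := by
      rintro y hy x ⟨w, hwx, hs⟩ hxy
      by_cases h : f x * f y < 0
      · exact ⟨x, hxy, h⟩
      · refine ⟨w, hwx.trans hxy, ?_⟩
        have hx : f x ≠ 0 := right_ne_zero_of_mul hs.ne
        have h' : 0 < f x * f y := lt_of_le_of_ne (not_lt.1 h) (mul_ne_zero hx hy).symm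
        by_contra! h''
        nlinarith [mul_neg_of_neg_of_pos hs h', mul_nonneg h'' (sq_nonneg (f x))]
    have hbdd : ∀ x ∈ S, x₀ ≤ x := by
      intro x hx
      by_contra! hlt
      obtain ⟨z, hz, hs⟩ := prepend x₀ hx₀.ne_zero x hx hlt
      exact hf z ⟨x₀, hz, hs, hx₀⟩
    have hne : S.Nonempty := by
      obtain ⟨y, hy, hs, -⟩ := hx₀
      exact ⟨y, x₀, hy, hs⟩
    set c := sInf S with hc
    have hcle : ∀ x ∈ S, c ≤ x := fun x hx => csInf_le ⟨x₀, hbdd⟩ hx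
    have before : ∀ y, c < y → f y ≠ 0 → ∃ z, z < y ∧ f z * f y < 0 := by
      intro y hy h0
      obtain ⟨x, hx, hxy⟩ := exists_lt_of_csInf_lt hne hy
      exact prepend y h0 x hx hxy
    have right : ∀ (k : ℕ) (y : ℝ), c < y → AlternatesFrom (fun x => (x - c) * f x) k y →
        AlternatesFrom f k y := by
      intro k
      induction k with
      | zero => exact fun y _ h => right_ne_zero_of_mul h
      | succ k ihk =>
        rintro y hy ⟨z, hyz, hs, hz⟩
        refine ⟨z, hyz, ?_, ihk z (hy.trans hyz) hz⟩
        have h' : ((y - c) * (z - c)) * (f y * f z) < 0 := by linarith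
        exact (pos_iff_neg_of_mul_neg h').1 (mul_pos (sub_pos.2 hy) (sub_pos.2 (hy.trans hyz)))
    have hg : ∀ x, ¬ AlternatesFrom (fun x => (x - c) * f x) (n + 1) x := by
      intro y₀ h
      have hy₀ := h.ne_zero
      rcases lt_trichotomy y₀ c with hlt | heq | hgt
      · obtain ⟨y₁, hy, hs, hy₁⟩ := h
        have h1 := hy₁.ne_zero
        have hcy₁ : c < y₁ := by
          by_contra! hle
          rcases hle.lt_or_eq with hlt' | heq'
          · have h' : ((y₀ - c) * (y₁ - c)) * (f y₀ * f y₁) < 0 := by linarith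
            have := (pos_iff_neg_of_mul_neg h').1
              (mul_pos_of_neg_of_neg (sub_neg.2 hlt) (sub_neg.2 hlt'))
            exact absurd (hcle y₁ ⟨y₀, hy, this⟩) hlt'.not_ge
          · simp [heq'] at h1
        have hsame : 0 < f y₀ * f y₁ := by
          have h' : ((y₀ - c) * (y₁ - c)) * (f y₀ * f y₁) < 0 := by linarith
          exact (neg_iff_pos_of_mul_neg h').1
            (mul_neg_of_neg_of_pos (sub_neg.2 hlt) (sub_pos.2 hcy₁))
        obtain ⟨z, hz, hzs⟩ := before y₁ hcy₁ (right_ne_zero_of_mul h1)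
        have hzs' : f y₀ * f z < 0 := by
          by_contra! h''
          nlinarith [mul_neg_of_neg_of_pos hzs hsame, mul_nonneg h'' (sq_nonneg (f y₁))]
        have hyz : y₀ < z := by
          rcases lt_trichotomy y₀ z with h2 | h2 | h2
          · exact h2
          · rw [h2] at hzs'
            exact absurd hzs' (mul_self_nonneg _).not_gt
          · exact absurd (hcle y₀ ⟨z, h2, by linarith [mul_comm (f y₀) (f z)]⟩) hlt.not_ge
        exact hf y₀ ⟨z, hyz, hzs', y₁, hz, hzs, right n y₁ hcy₁ hy₁⟩
      · simp [heq] at hy₀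
      · obtain ⟨z, hz, hs⟩ := before y₀ hgt (right_ne_zero_of_mul hy₀)
        exact hf z ⟨y₀, hz, hs, right _ _ hgt h⟩
    obtain ⟨r, h0, hd, hr⟩ := ih hg
    refine ⟨(X - C c) * r, mul_ne_zero (X_sub_C_ne_zero c) h0, ?_, fun x => ?_⟩
    · refine natDegree_mul_le.trans ?_
      rw [natDegree_X_sub_C]
      omega
    · have := hr x
      simp only [eval_mul, eval_sub, eval_X, eval_C]
      linarith

end AlternatesFrom

/-- The logarithmic derivative of `(l ^ 2 + k) * exp (k * x ^ 2 / 2 + e * x)` in terms of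
`l = k * x + e`. -/
def logDerivTerm (k l : ℝ) : ℝ := l * (l ^ 2 + 3 * k) / (l ^ 2 + k)

lemma hasDerivAt_linear (k e x : ℝ) : HasDerivAt (fun x => k * x + e) k x := by
  simpa using ((hasDerivAt_id x).const_mul k).add_const e

lemma hasDerivAt_logDerivTerm {k e x : ℝ} (h : 0 < (k * x + e) ^ 2 + k) :
    HasDerivAt (fun x => logDerivTerm k (k * x + e))
      (k * ((k * x + e) ^ 4 + 3 * k ^ 2) / ((k * x + e) ^ 2 + k) ^ 2) x := by
  have hl := hasDerivAt_linear k e x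
  have := (hl.mul ((hl.pow 2).add_const (3 * k))).div ((hl.pow 2).add_const k) h.ne'
  refine this.congr_deriv ?_
  simp only [Pi.mul_apply, Pi.pow_apply]
  field_simp
  push_cast
  ring

/-- On a level set of `logDerivTerm`, the derivative is a rational function of `l` alone. -/
lemma logDerivTerm_deriv_eq {k l : ℝ} (hk : 0 ≤ k) (hl : 0 < l) :
    0 < 3 * l - logDerivTerm k l ∧
    k * (3 * l - logDerivTerm k l) = l ^ 2 * (logDerivTerm k l - l) ∧
    k * (l ^ 4 + 3 * k ^ 2) / (l ^ 2 + k) ^ 2 * (3 * l - logDerivTerm k l) =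
      (logDerivTerm k l - l) *
        (3 * l ^ 2 - 3 * l * logDerivTerm k l + logDerivTerm k l ^ 2) := by
  have hw : 0 < l ^ 2 + k := by positivity
  unfold logDerivTerm
  refine ⟨?_, ?_, ?_⟩
  · have : 3 * l - l * (l ^ 2 + 3 * k) / (l ^ 2 + k) = 2 * l ^ 3 / (l ^ 2 + k) := by
      field_simp; ring
    rw [this]; positivity
  · field_simp; ring
  · field_simp; ring

lemma logDerivTerm_deriv_lt_of_pos {k₁ k₂ l₁ l₂ : ℝ} (hk₂ : 0 ≤ k₂) (hk : k₂ < k₁)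
    (hl₁ : 0 < l₁) (hl₂ : 0 < l₂) (h : logDerivTerm k₂ l₂ = logDerivTerm k₁ l₁) :
    k₂ * (l₂ ^ 4 + 3 * k₂ ^ 2) / (l₂ ^ 2 + k₂) ^ 2 <
      k₁ * (l₁ ^ 4 + 3 * k₁ ^ 2) / (l₁ ^ 2 + k₁) ^ 2 := by
  obtain ⟨ha₁, hb₁, hc₁⟩ := logDerivTerm_deriv_eq (hk₂.trans hk.le) hl₁
  obtain ⟨ha₂, hb₂, hc₂⟩ := logDerivTerm_deriv_eq hk₂ hl₂
  rw [h] at ha₂ hb₂ hc₂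
  set t := logDerivTerm k₁ l₁
  set d₁ := k₁ * (l₁ ^ 4 + 3 * k₁ ^ 2) / (l₁ ^ 2 + k₁) ^ 2
  set d₂ := k₂ * (l₂ ^ 4 + 3 * k₂ ^ 2) / (l₂ ^ 2 + k₂) ^ 2
  clear_value t d₁ d₂
  obtain ⟨u, hu⟩ : ∃ u, u = 3 * l₁ - t := ⟨_, rfl⟩
  obtain ⟨v, hv⟩ : ∃ v, v = 3 * l₂ - t := ⟨_, rfl⟩
  obtain rfl : l₁ = (u + t) / 3 := by linarith
  obtain rfl : l₂ = (v + t) / 3 := by linarith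
  rw [← hu] at ha₁ hb₁ hc₁
  rw [← hv] at ha₂ hb₂ hc₂
  have huv : 0 < u * v := mul_pos ha₁ ha₂
  have ht : 0 < t := by
    have : 0 ≤ t - (u + t) / 3 := by
      refine nonneg_of_mul_nonneg_right ?_ (pow_pos hl₁ 2)
      rw [← hb₁]
      exact mul_nonneg (hk₂.trans hk.le) ha₁.le
    linarith
  have hkk : 27 * (u * v) * (k₁ - k₂) = (v - u) * (2 * t ^ 3 + u * v * (u + v)) := by
    linear_combination 27 * v * hb₁ - 27 * u * hb₂
  have hdd : 9 * (u * v) * (d₁ - d₂) = (v - u) * (2 * t ^ 3 + u * v * (u + v - 3 * t)) := by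
    linear_combination 9 * v * hc₁ - 9 * u * hc₂
  have hlt : 0 < v - u := by
    have h1 : 0 < (v - u) * (2 * t ^ 3 + u * v * (u + v)) := by
      rw [← hkk]
      exact mul_pos (by positivity) (sub_pos.2 hk)
    exact pos_of_mul_pos_left h1 (by positivity)
  have hpos : 0 < 2 * t ^ 3 + u * v * (u + v - 3 * t) := by
    rcases le_total (3 * t) (u + v) with h3 | h3
    · have := mul_nonneg huv.le (sub_nonneg.2 h3)
      positivity
    · nlinarith [mul_nonneg (sq_nonneg (u - v)) (sub_nonneg.2 h3), pow_pos ht 3,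
        mul_nonneg (sq_nonneg (u + v - 2 * t)) (by positivity : 0 ≤ u + v + t)]
  have : 0 < 9 * (u * v) * (d₁ - d₂) := by
    rw [hdd]
    exact mul_pos hlt hpos
  exact sub_pos.1 (pos_of_mul_pos_right this (by positivity))

lemma logDerivTerm_neg (k l : ℝ) : logDerivTerm k (-l) = -logDerivTerm k l := by
  simp only [logDerivTerm, even_two.neg_pow]
  ring

lemma logDerivTerm_pos_iff {k l : ℝ} (hk : 0 ≤ k) (h : 0 < l ^ 2 + k) :
    0 < logDerivTerm k l ↔ 0 < l := by
  have h3 : 0 < l ^ 2 + 3 * k := by linarith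
  rw [logDerivTerm, div_pos_iff_of_pos_right h, mul_pos_iff_of_pos_right h3]

lemma logDerivTerm_deriv_lt {k₁ k₂ l₁ l₂ : ℝ} (hk₂ : 0 ≤ k₂) (hk : k₂ < k₁)
    (hw : 0 < l₂ ^ 2 + k₂) (h : logDerivTerm k₂ l₂ = logDerivTerm k₁ l₁) :
    k₂ * (l₂ ^ 4 + 3 * k₂ ^ 2) / (l₂ ^ 2 + k₂) ^ 2 <
      k₁ * (l₁ ^ 4 + 3 * k₁ ^ 2) / (l₁ ^ 2 + k₁) ^ 2 := by
  have hk₁ : 0 < k₁ := hk₂.trans_lt hk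
  have hw₁ : 0 < l₁ ^ 2 + k₁ := by positivity
  have hpos : 0 < l₂ ↔ 0 < l₁ := by
    rw [← logDerivTerm_pos_iff hk₂ hw, h, logDerivTerm_pos_iff hk₁.le hw₁]
  have hneg : 0 < -l₂ ↔ 0 < -l₁ := by
    rw [← logDerivTerm_pos_iff hk₂ (by simpa using hw), logDerivTerm_neg, h, ← logDerivTerm_neg,
      logDerivTerm_pos_iff hk₁.le (by simpa using hw₁)]
  rcases lt_trichotomy l₂ 0 with h₂ | rfl | h₂
  · have h₁ := hneg.1 (neg_pos.2 h₂)
    simpa only [even_two.neg_pow, (by decide : Even 4).neg_pow] using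
      logDerivTerm_deriv_lt_of_pos hk₂ hk h₁ (neg_pos.2 h₂)
        (by rw [logDerivTerm_neg, logDerivTerm_neg, h])
  · have h₁ : l₁ = 0 := by
      rcases lt_trichotomy l₁ 0 with h1 | h1 | h1
      · simp [h1] at hneg
      · exact h1
      · simp [h1] at hpos
    have hk₂' : 0 < k₂ := by simpa using hw
    subst h₁
    have e : ∀ k : ℝ, 0 < k → k * ((0 : ℝ) ^ 4 + 3 * k ^ 2) / (0 ^ 2 + k) ^ 2 = 3 * k := by
      intro k hk
      field_simp
      ring
    rw [e _ hk₂', e _ hk₁]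
    linarith
  · exact logDerivTerm_deriv_lt_of_pos hk₂ hk (hpos.1 h₂) h₂ h

lemma logDerivTerm_crossing {k₁ k₂ e₁ e₂ : ℝ} (hk₂ : 0 ≤ k₂) (hk : k₂ ≤ k₁)
    (hw₁ : ∀ x, 0 < (k₁ * x + e₁) ^ 2 + k₁) (hw₂ : ∀ x, 0 < (k₂ * x + e₂) ^ 2 + k₂) {x y : ℝ}
    (hxy : x < y) (hx : 0 < logDerivTerm k₁ (k₁ * x + e₁) - logDerivTerm k₂ (k₂ * x + e₂)) :
    0 ≤ logDerivTerm k₁ (k₁ * y + e₁) - logDerivTerm k₂ (k₂ * y + e₂) := by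
  rcases hk.lt_or_eq with hk | rfl
  · have hd₁ := fun z => hasDerivAt_logDerivTerm (hw₁ z)
    have hd₂ := fun z => hasDerivAt_logDerivTerm (hw₂ z)
    have := image_le_of_deriv_right_lt_deriv_boundary (a := x) (b := y)
      (fun z _ => (hd₂ z).continuousAt.continuousWithinAt) (fun z _ => (hd₂ z).hasDerivWithinAt)
      (sub_pos.1 hx).le hd₁ (fun z _ hz => logDerivTerm_deriv_lt hk₂ hk (hw₂ z) hz)
      (Set.right_mem_Icc.2 hxy.le)
    exact sub_nonneg.2 this
  · have key : ∀ z, (logDerivTerm k₂ (k₂ * z + e₁) - logDerivTerm k₂ (k₂ * z + e₂)) *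
        (((k₂ * z + e₁) ^ 2 + k₂) * ((k₂ * z + e₂) ^ 2 + k₂)) =
        (e₁ - e₂) * ((k₂ * z + e₁) ^ 2 * (k₂ * z + e₂) ^ 2 + k₂ * (e₁ - e₂) ^ 2 + 3 * k₂ ^ 2) := by
      intro z
      have h1 := (hw₁ z).ne'
      have h2 := (hw₂ z).ne'
      unfold logDerivTerm
      field_simp
      ring
    have he : 0 < e₁ - e₂ := by
      have h1 := mul_pos hx (mul_pos (hw₁ x) (hw₂ x))
      rw [key] at h1
      exact pos_of_mul_pos_left h1 (by positivity)
    refine nonneg_of_mul_nonneg_left ?_ (mul_pos (hw₁ y) (hw₂ y))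
    rw [key]
    positivity

lemma hasDerivAt_expQuadratic (k e x : ℝ) :
    HasDerivAt (fun x => Real.exp (k * x ^ 2 / 2 + e * x))
      ((k * x + e) * Real.exp (k * x ^ 2 / 2 + e * x)) x := by
  have h : HasDerivAt (fun x : ℝ => k * x ^ 2 / 2 + e * x) (k * x + e) x := by
    refine ((((hasDerivAt_id x).pow 2).const_mul k).div_const 2 |>.add
      ((hasDerivAt_id x).const_mul e)).congr_deriv ?_
    simp
    ring
  exact h.exp.congr_deriv (mul_comm _ _)

/-- Two terms, each the second derivative of the exponential of a convex quadratic. -/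
lemma not_alternatesFrom_two_terms {k₁ k₂ : ℝ} (e₁ e₂ c₁ c₂ : ℝ) (hk₁ : 0 ≤ k₁) (hk₂ : 0 ≤ k₂)
    (x : ℝ) :
    ¬ AlternatesFrom (fun x =>
      c₁ * (((k₁ * x + e₁) ^ 2 + k₁) * Real.exp (k₁ * x ^ 2 / 2 + e₁ * x)) +
      c₂ * (((k₂ * x + e₂) ^ 2 + k₂) * Real.exp (k₂ * x ^ 2 / 2 + e₂ * x))) 3 x := by
  wlog hk : k₂ ≤ k₁ generalizing k₁ k₂ e₁ e₂ c₁ c₂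
  · have := this e₂ e₁ c₂ c₁ hk₂ hk₁ (le_of_not_ge hk)
    simpa only [add_comm] using this
  wlog hc₁ : 0 ≤ c₁ generalizing c₁ c₂
  · intro h
    refine this (-c₁) (-c₂) (by linarith) ?_
    convert! h.neg using 2
    ring
  rcases hc₁.eq_or_lt with rfl | hc₁
  · rcases le_total 0 c₂ with hc | hc
    · exact AlternatesFrom.not_of_nonneg (fun y => by positivity) x
    · refine AlternatesFrom.not_of_nonpos (fun y => ?_) x
      have : 0 ≤ -c₂ * (((k₂ * y + e₂) ^ 2 + k₂) * Real.exp (k₂ * y ^ 2 / 2 + e₂ * y)) :=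
        mul_nonneg (by linarith) (by positivity)
      linarith
  rcases le_or_gt 0 c₂ with hc₂ | hc₂
  · exact AlternatesFrom.not_of_nonneg (fun y => by positivity) x
  have hw : ∀ {k e : ℝ}, 0 ≤ k → ¬ (k = 0 ∧ e = 0) → ∀ y, 0 < (k * y + e) ^ 2 + k := by
    intro k e hk h y
    rcases hk.eq_or_lt with rfl | hk
    · have : e ≠ 0 := fun he => h ⟨rfl, he⟩
      simpa using (sq_pos_of_ne_zero this)
    · positivity
  by_cases h₂ : k₂ = 0 ∧ e₂ = 0
  · obtain ⟨rfl, rfl⟩ := h₂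
    exact AlternatesFrom.not_of_nonneg (fun y => by simp; positivity) x
  by_cases h₁ : k₁ = 0 ∧ e₁ = 0
  · obtain ⟨rfl, rfl⟩ := h₁
    refine AlternatesFrom.not_of_nonpos (fun y => ?_) x
    have : 0 ≤ -c₂ * (((k₂ * y + e₂) ^ 2 + k₂) * Real.exp (k₂ * y ^ 2 / 2 + e₂ * y)) :=
      mul_nonneg (by linarith) (by positivity)
    simp
    linarith
  have hw₁ := hw hk₁ h₁
  have hw₂ := hw hk₂ h₂
  let g : ℝ → ℝ := fun y =>
    (Real.log c₁ + Real.log ((k₁ * y + e₁) ^ 2 + k₁) + (k₁ * y ^ 2 / 2 + e₁ * y)) -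
    (Real.log (-c₂) + Real.log ((k₂ * y + e₂) ^ 2 + k₂) + (k₂ * y ^ 2 / 2 + e₂ * y))
  have hexp : ∀ {c k e : ℝ} (y : ℝ), 0 < c → 0 < (k * y + e) ^ 2 + k →
      c * (((k * y + e) ^ 2 + k) * Real.exp (k * y ^ 2 / 2 + e * y)) =
      Real.exp (Real.log c + Real.log ((k * y + e) ^ 2 + k) + (k * y ^ 2 / 2 + e * y)) := by
    intro c k e y hc hw
    rw [Real.exp_add (Real.log c + _), Real.exp_add (Real.log c), Real.exp_log hc, Real.exp_log hw,
      mul_assoc]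
  have hlog : ∀ {c k e : ℝ} (y : ℝ), 0 < (k * y + e) ^ 2 + k →
      HasDerivAt (fun y => Real.log c + Real.log ((k * y + e) ^ 2 + k) + (k * y ^ 2 / 2 + e * y))
        (logDerivTerm k (k * y + e)) y := by
    intro c k e y hw
    have hl := hasDerivAt_linear k e y
    have hq : HasDerivAt (fun y : ℝ => k * y ^ 2 / 2 + e * y) (k * y + e) y := by
      refine ((((hasDerivAt_id y).pow 2).const_mul k).div_const 2 |>.add
        ((hasDerivAt_id y).const_mul e)).congr_deriv ?_
      simp
      ring
    refine (((((hl.pow 2).add_const k).log hw.ne').const_add (Real.log c)).add hq).congr_deriv ?_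
    unfold logDerivTerm
    simp only [Pi.pow_apply]
    field_simp
    push_cast
    ring
  have hg : ∀ y, HasDerivAt g
      (logDerivTerm k₁ (k₁ * y + e₁) - logDerivTerm k₂ (k₂ * y + e₂)) y :=
    fun y => (hlog y (hw₁ y)).sub (hlog y (hw₂ y))
  have hD : ∀ y, ¬ AlternatesFrom
      (fun y => logDerivTerm k₁ (k₁ * y + e₁) - logDerivTerm k₂ (k₂ * y + e₂)) 2 y := by
    rintro a ⟨b, hab, hs, d, hbd, hs', -⟩
    rcases mul_neg_iff.1 hs with ⟨ha, hb⟩ | ⟨ha, hb⟩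
    · exact absurd hb (logDerivTerm_crossing hk₂ hk hw₁ hw₂ hab ha).not_gt
    · exact absurd ((pos_iff_neg_of_mul_neg hs').1 hb)
        (logDerivTerm_crossing hk₂ hk hw₁ hw₂ hbd hb).not_gt
  intro h
  refine AlternatesFrom.deriv_of_forall_not hg hD x (h.of_pos_iff (fun y => ?_) (fun y => ?_))
  · refine Iff.trans ?_ (sub_pos.trans Real.exp_lt_exp.symm).symm
    rw [← hexp y hc₁ (hw₁ y), ← hexp y (neg_pos.2 hc₂) (hw₂ y)]
    constructor <;> intro h <;> linarith
  · refine Iff.trans ?_ (sub_neg.trans Real.exp_lt_exp.symm).symm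
    rw [← hexp y hc₁ (hw₁ y), ← hexp y (neg_pos.2 hc₂) (hw₂ y)]
    constructor <;> intro h <;> linarith

/-- A combination of three Gaussian bumps, the third being the narrowest, reduces after division
by the third and two differentiations to two terms. -/
lemma not_alternatesFrom_of_second_deriv {κ₁ κ₂ κ₃ μ₁ μ₂ μ₃ : ℝ} (c₁ c₂ c₃ : ℝ) {n : ℕ}
    (h : ∀ x, ¬ AlternatesFrom (fun x =>
      c₁ * Real.exp (κ₃ * μ₃ ^ 2 / 2 - κ₁ * μ₁ ^ 2 / 2) *
        ((((κ₃ - κ₁) * x + (κ₁ * μ₁ - κ₃ * μ₃)) ^ 2 + (κ₃ - κ₁)) *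
          Real.exp ((κ₃ - κ₁) * x ^ 2 / 2 + (κ₁ * μ₁ - κ₃ * μ₃) * x)) +
      c₂ * Real.exp (κ₃ * μ₃ ^ 2 / 2 - κ₂ * μ₂ ^ 2 / 2) *
        ((((κ₃ - κ₂) * x + (κ₂ * μ₂ - κ₃ * μ₃)) ^ 2 + (κ₃ - κ₂)) *
          Real.exp ((κ₃ - κ₂) * x ^ 2 / 2 + (κ₂ * μ₂ - κ₃ * μ₃) * x))) n x) (x : ℝ) :
    ¬ AlternatesFrom (fun x => c₁ * Real.exp (-κ₁ * (x - μ₁) ^ 2 / 2) +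
      c₂ * Real.exp (-κ₂ * (x - μ₂) ^ 2 / 2) + c₃ * Real.exp (-κ₃ * (x - μ₃) ^ 2 / 2))
      (n + 2) x := by
  set d₁ := c₁ * Real.exp (κ₃ * μ₃ ^ 2 / 2 - κ₁ * μ₁ ^ 2 / 2) with hd₁
  set d₂ := c₂ * Real.exp (κ₃ * μ₃ ^ 2 / 2 - κ₂ * μ₂ ^ 2 / 2) with hd₂
  set k₁ := κ₃ - κ₁ with hk₁
  set k₂ := κ₃ - κ₂ with hk₂
  set e₁ := κ₁ * μ₁ - κ₃ * μ₃ with he₁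
  set e₂ := κ₂ * μ₂ - κ₃ * μ₃ with he₂
  have h0 : ∀ y, HasDerivAt (fun y => d₁ * Real.exp (k₁ * y ^ 2 / 2 + e₁ * y) +
      d₂ * Real.exp (k₂ * y ^ 2 / 2 + e₂ * y) + c₃)
      (d₁ * ((k₁ * y + e₁) * Real.exp (k₁ * y ^ 2 / 2 + e₁ * y)) +
      d₂ * ((k₂ * y + e₂) * Real.exp (k₂ * y ^ 2 / 2 + e₂ * y))) y := fun y =>
    (((hasDerivAt_expQuadratic k₁ e₁ y).const_mul d₁).add
      ((hasDerivAt_expQuadratic k₂ e₂ y).const_mul d₂)).add_const c₃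
  have h1 : ∀ k e y, HasDerivAt (fun y => (k * y + e) * Real.exp (k * y ^ 2 / 2 + e * y))
      (((k * y + e) ^ 2 + k) * Real.exp (k * y ^ 2 / 2 + e * y)) y := fun k e y =>
    ((hasDerivAt_linear k e y).mul (hasDerivAt_expQuadratic k e y)).congr_deriv (by ring)
  have h2 : ∀ y, HasDerivAt (fun y => d₁ * ((k₁ * y + e₁) * Real.exp (k₁ * y ^ 2 / 2 + e₁ * y)) +
      d₂ * ((k₂ * y + e₂) * Real.exp (k₂ * y ^ 2 / 2 + e₂ * y)))
      (d₁ * (((k₁ * y + e₁) ^ 2 + k₁) * Real.exp (k₁ * y ^ 2 / 2 + e₁ * y)) +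
      d₂ * (((k₂ * y + e₂) ^ 2 + k₂) * Real.exp (k₂ * y ^ 2 / 2 + e₂ * y))) y := fun y =>
    ((h1 k₁ e₁ y).const_mul d₁).add ((h1 k₂ e₂ y).const_mul d₂)
  intro hx
  refine AlternatesFrom.deriv_of_forall_not h0 (AlternatesFrom.deriv_of_forall_not h2 h) x
    (AlternatesFrom.of_mul_pos (w := fun y => Real.exp (-κ₃ * (y - μ₃) ^ 2 / 2))
      (fun y => Real.exp_pos _) ?_)
  convert! hx using 2 with y
  rw [hd₁, hd₂, hk₁, hk₂, he₁, he₂]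
  have e1 : ∀ κ μ : ℝ, Real.exp (-κ * (y - μ) ^ 2 / 2) = Real.exp (-κ₃ * (y - μ₃) ^ 2 / 2) *
      (Real.exp (κ₃ * μ₃ ^ 2 / 2 - κ * μ ^ 2 / 2) *
        Real.exp ((κ₃ - κ) * y ^ 2 / 2 + (κ * μ - κ₃ * μ₃) * y)) := by
    intro κ μ
    rw [← Real.exp_add, ← Real.exp_add]
    congr 1
    ring
  rw [e1 κ₁ μ₁, e1 κ₂ μ₂]
  ring

lemma not_alternatesFrom_three_gaussians_of_le {κ₁ κ₂ κ₃ : ℝ} (μ₁ μ₂ μ₃ c₁ c₂ c₃ : ℝ)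
    (h₁ : κ₁ ≤ κ₃) (h₂ : κ₂ ≤ κ₃) (x : ℝ) :
    ¬ AlternatesFrom (fun x => c₁ * Real.exp (-κ₁ * (x - μ₁) ^ 2 / 2) +
      c₂ * Real.exp (-κ₂ * (x - μ₂) ^ 2 / 2) + c₃ * Real.exp (-κ₃ * (x - μ₃) ^ 2 / 2)) 5 x :=
  not_alternatesFrom_of_second_deriv c₁ c₂ c₃ (n := 3)
    (not_alternatesFrom_two_terms _ _ _ _ (sub_nonneg.2 h₁) (sub_nonneg.2 h₂)) x

/-- A combination of three Gaussian bumps has at most four sign alternations. -/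
theorem not_alternatesFrom_three_gaussians (κ₁ κ₂ κ₃ μ₁ μ₂ μ₃ c₁ c₂ c₃ x : ℝ) :
    ¬ AlternatesFrom (fun x => c₁ * Real.exp (-κ₁ * (x - μ₁) ^ 2 / 2) +
      c₂ * Real.exp (-κ₂ * (x - μ₂) ^ 2 / 2) + c₃ * Real.exp (-κ₃ * (x - μ₃) ^ 2 / 2)) 5 x := by
  by_cases h₃ : κ₁ ≤ κ₃ ∧ κ₂ ≤ κ₃
  · exact not_alternatesFrom_three_gaussians_of_le _ _ _ _ _ _ h₃.1 h₃.2 x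
  rcases le_total κ₁ κ₂ with h | h
  · have h' : κ₃ ≤ κ₂ := by
      by_contra! hlt
      exact h₃ ⟨h.trans hlt.le, hlt.le⟩
    convert! not_alternatesFrom_three_gaussians_of_le μ₁ μ₃ μ₂ c₁ c₃ c₂ h h' x using 3
    ring
  · have h' : κ₃ ≤ κ₁ := by
      by_contra! hlt
      exact h₃ ⟨hlt.le, h.trans hlt.le⟩
    convert! not_alternatesFrom_three_gaussians_of_le μ₃ μ₂ μ₁ c₃ c₂ c₁ h' h x using 3
    ring

lemma not_alternatesFrom_two_gaussians_of_le {κ₁ κ₂ : ℝ} (μ₁ μ₂ c₁ c₂ : ℝ) (h : κ₁ ≤ κ₂) (x : ℝ) :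
    ¬ AlternatesFrom (fun x => c₁ * Real.exp (-κ₁ * (x - μ₁) ^ 2 / 2) +
      c₂ * Real.exp (-κ₂ * (x - μ₂) ^ 2 / 2)) 3 x := by
  have hk := sub_nonneg.2 h
  have key := not_alternatesFrom_of_second_deriv (κ₁ := κ₁) (κ₂ := κ₂) (κ₃ := κ₂) (μ₁ := μ₁)
    (μ₂ := μ₂) (μ₃ := μ₂) c₁ 0 c₂ (n := 1) (fun y => by
      rcases le_total 0 c₁ with hc | hc
      · exact AlternatesFrom.not_of_nonneg (fun z => by simp; positivity) y
      · refine AlternatesFrom.not_of_nonpos (fun z => ?_) y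
        simp only [zero_mul, add_zero]
        exact mul_nonpos_of_nonpos_of_nonneg
          (mul_nonpos_of_nonpos_of_nonneg hc (Real.exp_pos _).le) (by positivity)) x
  simpa using key

/-- A combination of two Gaussian bumps has at most two sign alternations. -/
theorem not_alternatesFrom_two_gaussians (κ₁ κ₂ μ₁ μ₂ c₁ c₂ x : ℝ) :
    ¬ AlternatesFrom (fun x => c₁ * Real.exp (-κ₁ * (x - μ₁) ^ 2 / 2) +
      c₂ * Real.exp (-κ₂ * (x - μ₂) ^ 2 / 2)) 3 x := by
  rcases le_total κ₁ κ₂ with h | h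
  · exact not_alternatesFrom_two_gaussians_of_le μ₁ μ₂ c₁ c₂ h x
  · simpa only [add_comm] using not_alternatesFrom_two_gaussians_of_le μ₂ μ₁ c₂ c₁ h x

open MeasureTheory ProbabilityTheory Polynomial
open scoped NNReal

/-- Moments of the Gaussian law of mean `a` and variance `v`. -/
def gaussianMoment (a v : ℝ) : ℕ → ℝ
  | 0 => 1
  | 1 => a
  | n + 2 => a * gaussianMoment a v (n + 1) + (n + 1) * v * gaussianMoment a v n

lemma integral_pow_gaussianReal (a : ℝ) (v : ℝ≥0) (n : ℕ) :
    ∫ x, x ^ n ∂gaussianReal a v = gaussianMoment a v n := by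
  set F : ℝ → ℝ := fun t => Real.exp (a * t + v * t ^ 2 / 2) with hF
  have hsm : ContDiff ℝ ⊤ F := by fun_prop
  have hd : ∀ (k : ℕ) (t : ℝ), HasDerivAt (iteratedDeriv k F) (iteratedDeriv (k + 1) F t) t := by
    intro k t
    rw [iteratedDeriv_succ]
    exact (hsm.differentiable_iteratedDeriv k
      (by exact_mod_cast WithTop.coe_lt_top _) t).hasDerivAt
  have h1 : ∀ t, iteratedDeriv 1 F t = (a + v * t) * F t := by
    intro t
    have h : HasDerivAt (fun t : ℝ => a * t + v * t ^ 2 / 2) (a + v * t) t := by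
      refine (((hasDerivAt_id t).const_mul a).add
        ((((hasDerivAt_id t).pow 2).const_mul (v : ℝ)).div_const 2)).congr_deriv ?_
      simp
      ring
    rw [iteratedDeriv_one, h.exp.deriv, mul_comm]
  have hrec : ∀ (k : ℕ) (t : ℝ), iteratedDeriv (k + 2) F t =
      (a + v * t) * iteratedDeriv (k + 1) F t + (k + 1) * v * iteratedDeriv k F t := by
    have hl : ∀ t : ℝ, HasDerivAt (fun t : ℝ => a + v * t) v t := fun t => by
      simpa using ((hasDerivAt_id t).const_mul (v : ℝ)).const_add a
    intro k
    induction k with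
    | zero =>
      intro t
      have h2 := (hd 1 t).unique ((((hl t).mul (hd 0 t))).congr_of_eventuallyEq
        (Filter.Eventually.of_forall fun s => by simp [h1]))
      simp only [iteratedDeriv_zero] at h2 ⊢
      rw [h2]
      push_cast
      ring
    | succ k ih =>
      intro t
      have h2 := (hd (k + 2) t).unique ((((hl t).mul (hd (k + 1) t)).add
        ((hd k t).const_mul ((k + 1) * (v : ℝ)))).congr_of_eventuallyEq
        (Filter.Eventually.of_forall fun s => ih s))
      rw [h2]
      push_cast
      ring
  have hval : ∀ k, iteratedDeriv k F 0 = gaussianMoment a v k ∧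
      iteratedDeriv (k + 1) F 0 = gaussianMoment a v (k + 1) := by
    intro k
    induction k with
    | zero =>
      refine ⟨by simp [hF, gaussianMoment], ?_⟩
      rw [zero_add, h1]
      simp [hF, gaussianMoment]
    | succ k ih =>
      refine ⟨ih.2, ?_⟩
      rw [hrec, ih.1, ih.2, gaussianMoment]
      ring
  have h := iteratedDeriv_mgf_zero (X := id) (μ := gaussianReal a v) (by simp) n
  rw [mgf_id_gaussianReal] at h
  exact (by simpa using h.symm : _ = iteratedDeriv n F 0).trans (hval n).1

lemma integrable_eval_gaussianReal (a : ℝ) (v : ℝ≥0) (q : ℝ[X]) :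
    Integrable (fun x => q.eval x) (gaussianReal a v) := by
  simp only [eval_eq_sum_range]
  refine integrable_finsetSum _ fun i _ => Integrable.const_mul ?_ _
  have h := integrable_pow_of_mem_interior_integrableExpSet (X := id) (μ := gaussianReal a v)
    (by simp) i
  simpa using h

lemma integral_eval_gaussianReal (a : ℝ) (v : ℝ≥0) {q : ℝ[X]} {n : ℕ} (hq : q.natDegree < n) :
    ∫ x, q.eval x ∂gaussianReal a v = ∑ i ∈ Finset.range n, q.coeff i * gaussianMoment a v i := by
  simp only [eval_eq_sum_range' hq]
  rw [integral_finsetSum]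
  · simp only [integral_const_mul, integral_pow_gaussianReal]
  · intro i _
    simpa using (integrable_eval_gaussianReal a v (X ^ i)).const_mul (q.coeff i)

lemma gaussianPDFReal_eq (a : ℝ) (v : ℝ≥0) (x : ℝ) :
    gaussianPDFReal a v x =
      (√(2 * Real.pi * v))⁻¹ * Real.exp (-(v : ℝ)⁻¹ * (x - a) ^ 2 / 2) := by
  rw [gaussianPDFReal]
  congr 2
  field_simp

lemma integrable_eval_mul_gaussianPDFReal (a : ℝ) {v : ℝ≥0} (hv : v ≠ 0) (q : ℝ[X]) :
    Integrable (fun x => q.eval x * gaussianPDFReal a v x) := by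
  have h := integrable_eval_gaussianReal a v q
  rw [gaussianReal_of_var_ne_zero _ hv,
    integrable_withDensity_iff (measurable_gaussianPDF a v)
      (Filter.Eventually.of_forall fun _ => gaussianPDF_lt_top)] at h
  simpa using h

lemma integral_eval_gaussianReal_eq (a : ℝ) {v : ℝ≥0} (hv : v ≠ 0) (q : ℝ[X]) :
    ∫ x, q.eval x ∂gaussianReal a v = ∫ x, q.eval x * gaussianPDFReal a v x := by
  simp only [integral_gaussianReal_eq_integral_smul hv, smul_eq_mul, mul_comm]

/-- A function with nonzero integral cannot have the sign of a nonzero polynomial against which it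
integrates to zero. -/
lemma false_of_integral_eval_mul_eq_zero {h : ℝ → ℝ} {q : ℝ[X]} (hq : q ≠ 0)
    (hpos : ∀ x, 0 ≤ q.eval x * h x) (hqh : Integrable (fun x => q.eval x * h x))
    (hzero : ∫ x, q.eval x * h x = 0) (hne : ∫ x, h x ≠ 0) : False := by
  rw [integral_eq_zero_iff_of_nonneg hpos hqh] at hzero
  refine hne (integral_eq_zero_of_ae ?_)
  have hroots : ∀ᵐ x : ℝ, x ∉ q.rootSet ℝ :=
    measure_eq_zero_iff_ae_notMem.1 ((q.rootSet_finite ℝ).measure_zero volume)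
  filter_upwards [hzero, hroots] with x hx hx'
  refine (mul_eq_zero.1 hx).resolve_left fun h0 => hx' ?_
  rw [mem_rootSet]
  exact ⟨hq, by simpa using h0⟩

lemma X_sub_C_sq_mul {a : ℝ} {r : ℝ[X]} {n : ℕ} (h0 : r ≠ 0) (hd : r.natDegree ≤ n) :
    (X - C a) ^ 2 * r ≠ 0 ∧ ((X - C a) ^ 2 * r).natDegree ≤ n + 2 := by
  refine ⟨mul_ne_zero (pow_ne_zero 2 (X_sub_C_ne_zero a)) h0, natDegree_mul_le.trans ?_⟩
  rw [natDegree_pow, natDegree_X_sub_C]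
  omega

/-- A Gaussian law does not share its moments up to order six with a mixture of a point mass and two
Gaussian laws or point masses. -/
theorem false_of_mixture_moments_eq {p₁ p₂ p₃ P a₁ a₂ a₃ : ℝ} {v₂ v₃ v₀ : ℝ≥0} (hp₁ : 0 < p₁)
    (hp₂ : 0 < p₂) (hp₃ : 0 < p₃) (hP : P = p₁ + p₂ + p₃) (hv₀ : v₀ ≠ 0)
    (hm : ∀ q : ℝ[X], q.natDegree ≤ 6 →
      p₁ * q.eval a₁ + p₂ * ∫ x, q.eval x ∂gaussianReal a₂ v₂ +
        p₃ * ∫ x, q.eval x ∂gaussianReal a₃ v₃ = P * ∫ x, q.eval x ∂gaussianReal 0 v₀) : False := by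
  wlog h₂₃ : v₃ = 0 → v₂ = 0 generalizing p₂ p₃ a₂ a₃ v₂ v₃
  · refine this (a₂ := a₃) (a₃ := a₂) (v₂ := v₃) (v₃ := v₂) hp₃ hp₂ (by linarith)
      (fun q hq => by linarith [hm q hq]) fun h => ?_
    push Not at h₂₃
    exact absurd h h₂₃.2
  have hI : ∀ (a : ℝ) {v : ℝ≥0}, v ≠ 0 → ∀ (c : ℝ) (q : ℝ[X]),
      Integrable (fun x => c * (q.eval x * gaussianPDFReal a v x)) := fun a v hv c q =>
    (integrable_eval_mul_gaussianPDFReal a hv q).const_mul c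
  have hJ : ∀ (a : ℝ) {v : ℝ≥0}, v ≠ 0 → ∀ c : ℝ,
      Integrable (fun x => c * gaussianPDFReal a v x) := fun a v hv c =>
    (integrable_gaussianPDFReal a v).const_mul c
  by_cases h₃ : v₃ = 0
  · have h₂ := h₂₃ h₃
    subst h₂ h₃
    obtain ⟨q0, qd⟩ := X_sub_C_sq_mul (a := a₃) (one_ne_zero (α := ℝ[X])) (n := 0) (by simp)
    obtain ⟨q0, qd⟩ := X_sub_C_sq_mul (a := a₂) q0 qd
    obtain ⟨q0, qd⟩ := X_sub_C_sq_mul (a := a₁) q0 qd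
    have h := hm _ qd
    have hP0 : P ≠ 0 := by
      rw [hP]
      positivity
    simp only [gaussianReal_zero_var, integral_dirac, integral_eval_gaussianReal_eq _ hv₀] at h
    refine false_of_integral_eval_mul_eq_zero q0 (fun x => ?_)
      (integrable_eval_mul_gaussianPDFReal 0 hv₀ _) ?_ (by
        rw [integral_gaussianPDFReal_eq_one 0 hv₀]; exact one_ne_zero)
    · refine mul_nonneg ?_ (gaussianPDFReal_nonneg _ _ _)
      simp only [eval_mul, eval_pow, eval_sub, eval_X, eval_C, eval_one]
      positivity
    · refine (mul_eq_zero.1 (h.symm.trans ?_)).resolve_left hP0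
      simp
  by_cases h₂ : v₂ = 0
  · subst h₂
    obtain ⟨r, r0, rd, hr⟩ := AlternatesFrom.exists_polynomial
      (not_alternatesFrom_two_gaussians (v₃ : ℝ)⁻¹ (v₀ : ℝ)⁻¹ a₃ 0
        (p₃ * (√(2 * Real.pi * v₃))⁻¹) (-P * (√(2 * Real.pi * v₀))⁻¹))
    obtain ⟨q0, qd⟩ := X_sub_C_sq_mul (a := a₂) r0 rd
    obtain ⟨q0, qd⟩ := X_sub_C_sq_mul (a := a₁) q0 qd
    have h := hm _ qd
    simp only [gaussianReal_zero_var, integral_dirac, integral_eval_gaussianReal_eq _ hv₀,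
      integral_eval_gaussianReal_eq _ h₃] at h
    set q := (X - C a₁) ^ 2 * ((X - C a₂) ^ 2 * r) with hq
    have e : (fun x => q.eval x * (p₃ * gaussianPDFReal a₃ v₃ x + -P * gaussianPDFReal 0 v₀ x)) =
        fun x => p₃ * (q.eval x * gaussianPDFReal a₃ v₃ x) +
          -P * (q.eval x * gaussianPDFReal 0 v₀ x) := by
      ext x
      ring
    refine false_of_integral_eval_mul_eq_zero
      (h := fun x => p₃ * gaussianPDFReal a₃ v₃ x + -P * gaussianPDFReal 0 v₀ x) q0
      (fun x => ?_) ?_ ?_ ?_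
    · have := mul_nonneg (by positivity : 0 ≤ (x - a₁) ^ 2 * (x - a₂) ^ 2) (hr x)
      simp only [hq, eval_mul, eval_pow, eval_sub, eval_X, eval_C, gaussianPDFReal_eq]
      linarith
    · rw [e]
      exact (hI _ h₃ _ _).add (hI _ hv₀ _ _)
    · rw [e, integral_add (hI _ h₃ _ _) (hI _ hv₀ _ _), integral_const_mul, integral_const_mul,
        neg_mul, ← h]
      simp [hq]
    · rw [integral_add (hJ _ h₃ _) (hJ _ hv₀ _), integral_const_mul, integral_const_mul,
        integral_gaussianPDFReal_eq_one _ h₃, integral_gaussianPDFReal_eq_one _ hv₀]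
      linarith
  · obtain ⟨r, r0, rd, hr⟩ := AlternatesFrom.exists_polynomial
      (not_alternatesFrom_three_gaussians (v₂ : ℝ)⁻¹ (v₃ : ℝ)⁻¹ (v₀ : ℝ)⁻¹ a₂ a₃ 0
        (p₂ * (√(2 * Real.pi * v₂))⁻¹) (p₃ * (√(2 * Real.pi * v₃))⁻¹)
        (-P * (√(2 * Real.pi * v₀))⁻¹))
    obtain ⟨q0, qd⟩ := X_sub_C_sq_mul (a := a₁) r0 rd
    have h := hm _ qd
    simp only [integral_eval_gaussianReal_eq _ hv₀, integral_eval_gaussianReal_eq _ h₂,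
      integral_eval_gaussianReal_eq _ h₃] at h
    set q := (X - C a₁) ^ 2 * r with hq
    have e : (fun x => q.eval x * (p₂ * gaussianPDFReal a₂ v₂ x + p₃ * gaussianPDFReal a₃ v₃ x +
        -P * gaussianPDFReal 0 v₀ x)) =
        fun x => p₂ * (q.eval x * gaussianPDFReal a₂ v₂ x) +
          p₃ * (q.eval x * gaussianPDFReal a₃ v₃ x) +
          -P * (q.eval x * gaussianPDFReal 0 v₀ x) := by
      ext x
      ring
    have hI₂₃ : Integrable (fun x => p₂ * (q.eval x * gaussianPDFReal a₂ v₂ x) +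
        p₃ * (q.eval x * gaussianPDFReal a₃ v₃ x)) := (hI _ h₂ _ _).add (hI _ h₃ _ _)
    have hJ₂₃ : Integrable (fun x => p₂ * gaussianPDFReal a₂ v₂ x +
        p₃ * gaussianPDFReal a₃ v₃ x) := (hJ _ h₂ _).add (hJ _ h₃ _)
    refine false_of_integral_eval_mul_eq_zero
      (h := fun x => p₂ * gaussianPDFReal a₂ v₂ x + p₃ * gaussianPDFReal a₃ v₃ x +
        -P * gaussianPDFReal 0 v₀ x) q0 (fun x => ?_) ?_ ?_ ?_
    · have := mul_nonneg (sq_nonneg (x - a₁)) (hr x)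
      simp only [hq, eval_mul, eval_pow, eval_sub, eval_X, eval_C, gaussianPDFReal_eq]
      linarith
    · rw [e]
      exact hI₂₃.add (hI _ hv₀ _ _)
    · rw [e, integral_add hI₂₃ (hI _ hv₀ _ _),
        integral_add (hI _ h₂ _ _) (hI _ h₃ _ _), integral_const_mul, integral_const_mul,
        integral_const_mul, neg_mul, ← h]
      simp [hq]
    · rw [integral_add hJ₂₃ (hJ _ hv₀ _),
        integral_add (hJ _ h₂ _) (hJ _ h₃ _), integral_const_mul, integral_const_mul,
        integral_const_mul, integral_gaussianPDFReal_eq_one _ h₂,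
        integral_gaussianPDFReal_eq_one _ h₃, integral_gaussianPDFReal_eq_one _ hv₀]
      linarith

/-- The contribution of a component `(a, b)` of unit weight to the equation of index `α` in the
Gaussian over-fitting system. -/
def systemTerm (a b : ℝ) : ℕ → ℝ
  | 0 => 1
  | 1 => a
  | 2 => a ^ 2 / 2 + b
  | 3 => a ^ 3 / 6 + a * b
  | 4 => a ^ 4 / 24 + a ^ 2 * b / 2 + b ^ 2 / 2
  | 5 => a ^ 5 / 120 + a ^ 3 * b / 6 + a * b ^ 2 / 2
  | 6 => a ^ 6 / 720 + a ^ 4 * b / 24 + a ^ 2 * b ^ 2 / 4 + b ^ 3 / 6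
  | _ => 0

lemma sum_filter_eq_systemTerm (c a b : ℝ) {α : ℕ} (hα : α ≤ 6) :
    ∑ n ∈ Finset.filter (fun n : ℕ × ℕ => n.1 + 2 * n.2 = α)
        (Finset.range (α + 1) ×ˢ Finset.range (α + 1)),
      c ^ 2 * a ^ n.1 * b ^ n.2 / (n.1.factorial * n.2.factorial : ℝ) =
      c ^ 2 * systemTerm a b α := by
  simp only [Finset.sum_filter, Finset.sum_product]
  interval_cases α <;> simp [Finset.sum_range_succ, Nat.factorial, systemTerm] <;> ring

lemma ssysEq_three_iff {r : ℕ} (hr : r ≤ 6) (c a b : Fin 3 → ℝ) :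
    SsysEq 3 r c a b ↔ ∀ α, 1 ≤ α → α ≤ r → c 0 ^ 2 * systemTerm (a 0) (b 0) α +
      c 1 ^ 2 * systemTerm (a 1) (b 1) α + c 2 ^ 2 * systemTerm (a 2) (b 2) α = 0 := by
  refine forall_congr' fun α => forall_congr' fun _ => forall_congr' fun h => ?_
  rw [Fin.sum_univ_three]
  simp only [sum_filter_eq_systemTerm _ _ _ (h.trans hr)]

/-- The system has no solution with positive weights, nontrivial means and the smallest `b`
in the first component. -/
lemma false_of_systemTerm_eq_zero {p₁ p₂ p₃ a₁ a₂ a₃ b₁ b₂ b₃ : ℝ} (hp₁ : 0 < p₁) (hp₂ : 0 < p₂)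
    (hp₃ : 0 < p₃) (h₂ : b₁ ≤ b₂) (h₃ : b₁ ≤ b₃) (ha : a₁ ≠ 0 ∨ a₂ ≠ 0 ∨ a₃ ≠ 0)
    (h : ∀ α, 1 ≤ α → α ≤ 6 → p₁ * systemTerm a₁ b₁ α + p₂ * systemTerm a₂ b₂ α +
      p₃ * systemTerm a₃ b₃ α = 0) : False := by
  have e1 := h 1 (by norm_num) (by norm_num)
  have e2 := h 2 (by norm_num) (by norm_num)
  have e3 := h 3 (by norm_num) (by norm_num)
  have e4 := h 4 (by norm_num) (by norm_num)
  have e5 := h 5 (by norm_num) (by norm_num)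
  have e6 := h 6 (by norm_num) (by norm_num)
  simp only [systemTerm] at e1 e2 e3 e4 e5 e6
  have hb : b₁ < 0 := by
    have hpos : 0 < p₁ * a₁ ^ 2 + p₂ * a₂ ^ 2 + p₃ * a₃ ^ 2 := by
      rcases ha with ha | ha | ha <;> positivity
    have hlt : (p₁ + p₂ + p₃) * b₁ < 0 := by
      nlinarith [mul_le_mul_of_nonneg_left h₂ hp₂.le, mul_le_mul_of_nonneg_left h₃ hp₃.le]
    exact (pos_iff_neg_of_mul_neg hlt).1 (by positivity)
  obtain ⟨v₂, hv₂⟩ : ∃ v : ℝ≥0, (v : ℝ) = 2 * (b₂ - b₁) := ⟨⟨_, by linarith⟩, rfl⟩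
  obtain ⟨v₃, hv₃⟩ : ∃ v : ℝ≥0, (v : ℝ) = 2 * (b₃ - b₁) := ⟨⟨_, by linarith⟩, rfl⟩
  obtain ⟨v₀, hv₀⟩ : ∃ v : ℝ≥0, (v : ℝ) = 2 * -b₁ := ⟨⟨_, by linarith⟩, rfl⟩
  refine false_of_mixture_moments_eq (a₁ := a₁) (a₂ := a₂) (a₃ := a₃) (v₂ := v₂) (v₃ := v₃)
    (v₀ := v₀) hp₁ hp₂ hp₃ rfl ?_ fun q hq => ?_
  · rw [← NNReal.coe_ne_zero, hv₀]
    linarith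
  · have hq7 : q.natDegree < 7 := by omega
    rw [integral_eval_gaussianReal a₂ v₂ hq7, integral_eval_gaussianReal a₃ v₃ hq7,
      integral_eval_gaussianReal 0 v₀ hq7, eval_eq_sum_range' hq7, hv₂, hv₃, hv₀]
    have m2 : p₁ * a₁ ^ 2 + p₂ * gaussianMoment a₂ (2 * (b₂ - b₁)) 2 +
        p₃ * gaussianMoment a₃ (2 * (b₃ - b₁)) 2 =
        (p₁ + p₂ + p₃) * gaussianMoment 0 (2 * -b₁) 2 := by
      simp only [gaussianMoment]
      push_cast
      linear_combination 2 * e2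
    have m3 : p₁ * a₁ ^ 3 + p₂ * gaussianMoment a₂ (2 * (b₂ - b₁)) 3 +
        p₃ * gaussianMoment a₃ (2 * (b₃ - b₁)) 3 =
        (p₁ + p₂ + p₃) * gaussianMoment 0 (2 * -b₁) 3 := by
      simp only [gaussianMoment]
      push_cast
      linear_combination 6 * e3 - 6 * b₁ * e1
    have m4 : p₁ * a₁ ^ 4 + p₂ * gaussianMoment a₂ (2 * (b₂ - b₁)) 4 +
        p₃ * gaussianMoment a₃ (2 * (b₃ - b₁)) 4 =
        (p₁ + p₂ + p₃) * gaussianMoment 0 (2 * -b₁) 4 := by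
      simp only [gaussianMoment]
      push_cast
      linear_combination 24 * e4 - 24 * b₁ * e2
    have m5 : p₁ * a₁ ^ 5 + p₂ * gaussianMoment a₂ (2 * (b₂ - b₁)) 5 +
        p₃ * gaussianMoment a₃ (2 * (b₃ - b₁)) 5 =
        (p₁ + p₂ + p₃) * gaussianMoment 0 (2 * -b₁) 5 := by
      simp only [gaussianMoment]
      push_cast
      linear_combination 120 * e5 - 120 * b₁ * e3 + 60 * b₁ ^ 2 * e1
    have m6 : p₁ * a₁ ^ 6 + p₂ * gaussianMoment a₂ (2 * (b₂ - b₁)) 6 +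
        p₃ * gaussianMoment a₃ (2 * (b₃ - b₁)) 6 =
        (p₁ + p₂ + p₃) * gaussianMoment 0 (2 * -b₁) 6 := by
      simp only [gaussianMoment]
      push_cast
      linear_combination 720 * e6 - 720 * b₁ * e4 + 360 * b₁ ^ 2 * e2
    simp only [Finset.sum_range_succ, Finset.sum_range_zero, gaussianMoment.eq_1,
      gaussianMoment.eq_2]
    linear_combination q.coeff 1 * e1 + q.coeff 2 * m2 + q.coeff 3 * m3 + q.coeff 4 * m4 +
      q.coeff 5 * m5 + q.coeff 6 * m6

lemma not_nontrivSol_three_six : ¬ NontrivSol 3 6 := by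
  rintro ⟨c, a, b, h, hc, j, ha⟩
  rw [ssysEq_three_iff le_rfl] at h
  have hp : ∀ j, 0 < c j ^ 2 := fun j => by have := hc j; positivity
  have ha' : a 0 ≠ 0 ∨ a 1 ≠ 0 ∨ a 2 ≠ 0 := by
    fin_cases j <;> simp_all
  rcases le_total (b 0) (b 1) with h01 | h01
  · rcases le_total (b 0) (b 2) with h02 | h02
    · exact false_of_systemTerm_eq_zero (hp 0) (hp 1) (hp 2) h01 h02 ha' h
    · exact false_of_systemTerm_eq_zero (a₁ := a 2) (a₂ := a 0) (a₃ := a 1) (hp 2) (hp 0) (hp 1)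
        h02 (h02.trans h01) (by tauto)
        fun α h1 h6 => by linarith [h α h1 h6]
  · rcases le_total (b 1) (b 2) with h12 | h12
    · exact false_of_systemTerm_eq_zero (a₁ := a 1) (a₂ := a 0) (a₃ := a 2) (hp 1) (hp 0) (hp 2)
        h01 h12 (by tauto)
        fun α h1 h6 => by linarith [h α h1 h6]
    · exact false_of_systemTerm_eq_zero (a₁ := a 2) (a₂ := a 0) (a₃ := a 1) (hp 2) (hp 0) (hp 1)
        (h12.trans h01) h12 (by tauto)
        fun α h1 h6 => by linarith [h α h1 h6]

lemma NontrivSol.mono {m r s : ℕ} (hrs : r ≤ s) (h : NontrivSol m s) : NontrivSol m r := by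
  obtain ⟨c, a, b, h, hc, ha⟩ := h
  exact ⟨c, a, b, fun α h1 hr => h α h1 (hr.trans hrs), hc, ha⟩

lemma nontrivSol_three_five : NontrivSol 3 5 := by
  refine ⟨![1, 2, 1], ![-1, 0, 1], fun _ => -1 / 6, ?_, ?_, 0, by norm_num⟩
  · rw [ssysEq_three_iff (by norm_num)]
    intro α h1 h5
    simp only [Matrix.cons_val]
    interval_cases α <;> norm_num [systemTerm]
  · intro j
    fin_cases j <;> norm_num

end

/-- **Proposition 4.2(ii)**: for two extra components (`m = 3`), the system `S_{3,5}`
admits a nontrivial real solution while `S_{3,6}` does not; the solvability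
threshold is `r̄(3) = 6`. -/
theorem gaussian_system_threshold_two_extra :
    NontrivSol 3 5 ∧ ¬ NontrivSol 3 6 ∧
    IsLeast {r : ℕ | 1 ≤ r ∧ ¬ NontrivSol 3 r} 6 := by
  refine ⟨nontrivSol_three_five, not_nontrivSol_three_six, ⟨by norm_num, not_nontrivSol_three_six⟩,
    fun r hr => ?_⟩
  by_contra hlt
  exact hr.2 (nontrivSol_three_five.mono (by omega))
end
end
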